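/- arXiv:2509.17558 — 3 statements merged into one kernel-verified Lean document; each statement's English description precedes it below -/
import Mathlib

section
/- Let 0 < H₂ < H₁ < 1 and a, b ≠ 0. Define D_N := (ξ⁴_N ξ²_N − ξ⁸_N ξ¹_N)² − 4(ξ⁴_N ξ¹_N − (ξ²_N)²)(ξ⁸_N ξ²_N − (ξ⁴_N)²), x_N := (ξ⁸_N ξ¹_N − ξ⁴_N ξ²_N + ⁺√D_N) / (2(ξ⁴_N ξ¹_N − (ξ²_N)²)), y_N := (ξ⁸_N ξ¹_N − ξ⁴_N ξ²_N − ⁺√D_N) / (2(ξ⁴_N ξ¹_N − (ξ²_N)²)), and the estimators Ĥ_{1,N} := (1/(2 log 2)) log₊(x_N), Ĥ_{2,N} := (1/(2 log 2)) log₊(y_N), â²_N := (2Ĥ_{1,N}+1)(Ĥ_{1,N}+1)(ξ²_N − y_N ξ¹_N) / (2 h^{2Ĥ_{1,N}} (x_N − y_N)(x_N − 1)), b̂²_N := (2Ĥ_{2,N}+1)(Ĥ_{2,N}+1)(ξ²_N − x_N ξ¹_N) / (2 h^{2Ĥ_{2,N}} (y_N − x_N)(y_N − 1)). Then the random vector θ̂_N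 = (Ĥ_{1,N}, Ĥ_{2,N}, â²_N, b̂²_N) converges almost surely to θ = (H₁, H₂, a², b²) as N → ∞. -/
open MeasureTheory ProbabilityTheory Filter Real Matrix Topology

noncomputable section

variable {Ω : Type*} [MeasurableSpace Ω]

/-- A (centered) fractional Brownian motion with Hurst index `H` on the probability space
`(Ω, P)`: a jointly measurable process with a.s. continuous sample paths, whose
finite-dimensional distributions are centered Gaussian (equivalently, every finite linear
combination of values of the process is a centered real Gaussian random variable), with
covariance `E[W_s W_t] = (s^{2H} + t^{2H} - |s-t|^{2H})/2` for `s, t ≥ 0`. -/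
structure IsFBM (P : Measure Ω) (H : ℝ) (W : ℝ → Ω → ℝ) : Prop where
  jointMeasurable : Measurable (Function.uncurry W)
  gaussian_fdd : ∀ (n : ℕ) (t : Fin n → ℝ), (∀ i, 0 ≤ t i) → ∀ c : Fin n → ℝ,
    ∃ v : NNReal, P.map (fun ω => ∑ i, c i * W (t i) ω) = gaussianReal 0 v
  cov : ∀ s t : ℝ, 0 ≤ s → 0 ≤ t →
    ∫ ω, W s ω * W t ω ∂P = (s ^ (2*H) + t ^ (2*H) - |s - t| ^ (2*H)) / 2
  cont : ∀ᵐ ω ∂P, Continuous fun t => W t ω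

/-- The normalized integrated fractional Brownian motion (nifBm) with window `h`:
`X_t^{h,H} = (1/h) ∫_t^{t+h} W_u du`. -/
def nifBm (W : ℝ → Ω → ℝ) (h t : ℝ) (ω : Ω) : ℝ := (1/h) * ∫ u in t..(t+h), W u ω

/-- The function `γ(H, n)`. -/
def gam (H : ℝ) (n : ℤ) : ℝ :=
  (|(n:ℝ) - 2| ^ (2*H+2) - 4 * |(n:ℝ) - 1| ^ (2*H+2) + 6 * |(n:ℝ)| ^ (2*H+2)
    - 4 * |(n:ℝ) + 1| ^ (2*H+2) + |(n:ℝ) + 2| ^ (2*H+2)) / (4 * (2*H+1) * (H+1))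

/-- `log₊ x = log x` for `x > 0` and `0` otherwise. -/
def logpos (x : ℝ) : ℝ := if 0 < x then Real.log x else 0

/-- `X̃_k^{jh} = a X_{k·jh}^{jh,H₁} + b X_{k·jh}^{jh,H₂}`. -/
def tXj (W₁ W₂ : ℝ → Ω → ℝ) (a b h : ℝ) (j k : ℕ) (ω : Ω) : ℝ :=
  a * nifBm W₁ ((j:ℝ)*h) ((k:ℝ)*((j:ℝ)*h)) ω + b * nifBm W₂ ((j:ℝ)*h) ((k:ℝ)*((j:ℝ)*h)) ω

/-- The statistic `ξ^j_N = (1/N) ∑_{k=0}^{N-1} (X̃_{k+1}^{jh} - X̃_k^{jh})²`. -/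
def xiTwo (W₁ W₂ : ℝ → Ω → ℝ) (a b h : ℝ) (j N : ℕ) (ω : Ω) : ℝ :=
  (1/(N:ℝ)) * ∑ k ∈ Finset.range N,
    (tXj W₁ W₂ a b h j (k+1) ω - tXj W₁ W₂ a b h j k ω)^2

/-- `D_N` as a function of the four statistics. -/
def DStat (x1 x2 x4 x8 : ℝ) : ℝ :=
  (x4*x2 - x8*x1)^2 - 4*(x4*x1 - x2^2)*(x8*x2 - x4^2)

/-- `x_N` (the `⁺√` convention is realized by `Real.sqrt`, which vanishes on negatives,
and division by `0` equals `0` in Lean). -/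
def xStat (x1 x2 x4 x8 : ℝ) : ℝ :=
  (x8*x1 - x4*x2 + Real.sqrt (DStat x1 x2 x4 x8)) / (2*(x4*x1 - x2^2))

/-- `y_N`. -/
def yStat (x1 x2 x4 x8 : ℝ) : ℝ :=
  (x8*x1 - x4*x2 - Real.sqrt (DStat x1 x2 x4 x8)) / (2*(x4*x1 - x2^2))

/-- `Ĥ_{1,N}`. -/
def H1Stat (x1 x2 x4 x8 : ℝ) : ℝ := (1/(2*Real.log 2)) * logpos (xStat x1 x2 x4 x8)

/-- `Ĥ_{2,N}`. -/
def H2Stat (x1 x2 x4 x8 : ℝ) : ℝ := (1/(2*Real.log 2)) * logpos (yStat x1 x2 x4 x8)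

/-- `â²_N`. -/
def a2Stat (h x1 x2 x4 x8 : ℝ) : ℝ :=
  ((2*H1Stat x1 x2 x4 x8 + 1) * (H1Stat x1 x2 x4 x8 + 1) * (x2 - yStat x1 x2 x4 x8 * x1)) /
    (2 * h ^ (2*H1Stat x1 x2 x4 x8) * (xStat x1 x2 x4 x8 - yStat x1 x2 x4 x8)
      * (xStat x1 x2 x4 x8 - 1))

/-- `b̂²_N`. -/
def b2Stat (h x1 x2 x4 x8 : ℝ) : ℝ :=
  ((2*H2Stat x1 x2 x4 x8 + 1) * (H2Stat x1 x2 x4 x8 + 1) * (x2 - xStat x1 x2 x4 x8 * x1)) /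
    (2 * h ^ (2*H2Stat x1 x2 x4 x8) * (yStat x1 x2 x4 x8 - xStat x1 x2 x4 x8)
      * (yStat x1 x2 x4 x8 - 1))

/-- The fourth moment of a centered real Gaussian law. -/
theorem integral_pow_four_gaussianReal (v : NNReal) :
    ∫ x, x ^ 4 ∂gaussianReal 0 v = 3 * (v : ℝ) ^ 2 := by
  have h0 := iteratedDeriv_mgf_zero (X := id) (μ := gaussianReal 0 v) (by simp) 4
  have hd : ∀ (p p' : ℝ → ℝ), (∀ t, HasDerivAt p (p' t) t) →
      deriv (fun t => p t * rexp ((v : ℝ) * t ^ 2 / 2)) =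
        fun t => (p' t + v * t * p t) * rexp ((v : ℝ) * t ^ 2 / 2) := by
    intro p p' hp
    funext t
    have h1 : HasDerivAt (fun t : ℝ => (v : ℝ) * t ^ 2 / 2) (v * t) t := by
      have := ((hasDerivAt_pow 2 t).const_mul (v : ℝ)).div_const 2
      convert! this using 1
      norm_num
      ring
    refine HasDerivAt.deriv ?_
    convert! (hp t).mul h1.exp using 1
    ring
  have e1 : (fun t : ℝ => rexp (0 * t + (v : ℝ) * t ^ 2 / 2)) =
      fun t => 1 * rexp ((v : ℝ) * t ^ 2 / 2) := by
    funext t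
    simp
  simp only [Pi.pow_apply, id_eq] at h0
  rw [← h0, mgf_id_gaussianReal, e1, iteratedDeriv_succ', iteratedDeriv_succ', iteratedDeriv_succ',
    iteratedDeriv_succ', iteratedDeriv_zero,
    hd (fun _ => 1) (fun _ => 0) (fun t => hasDerivAt_const t 1),
    hd (fun t => 0 + v * t * 1) (fun _ => v) (fun t => by
      simpa using (hasDerivAt_id t).const_mul (v : ℝ)),
    hd (fun t => v + v * t * (0 + v * t * 1)) (fun t => 2 * v ^ 2 * t) (fun t => by
      have := ((hasDerivAt_pow 2 t).const_mul ((v : ℝ) ^ 2)).const_add (v : ℝ)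
      convert! this using 1
      · funext t; ring
      · norm_num; ring),
    hd (fun t => 2 * v ^ 2 * t + v * t * (v + v * t * (0 + v * t * 1)))
      (fun t => 3 * v ^ 2 + 3 * v ^ 3 * t ^ 2) (fun t => by
      have := ((hasDerivAt_id t).const_mul (3 * (v : ℝ) ^ 2)).add
        ((hasDerivAt_pow 3 t).const_mul ((v : ℝ) ^ 3))
      convert! this using 1
      · funext t; simp; ring
      · norm_num; ring)]
  simp

/-- A space of random variables all of which are centered Gaussian. -/
structure IsGaussianSpace (P : Measure Ω) (G : Submodule ℝ (Ω → ℝ)) : Prop where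
  measurable : ∀ X ∈ G, Measurable X
  gaussian : ∀ X ∈ G, ∃ v : NNReal, P.map X = gaussianReal 0 v

namespace IsGaussianSpace

variable {P : Measure Ω} {G : Submodule ℝ (Ω → ℝ)}

theorem memLp (hG : IsGaussianSpace P G) {X : Ω → ℝ} (hX : X ∈ G) (p : NNReal) : MemLp X p P := by
  obtain ⟨v, hv⟩ := hG.gaussian X hX
  have h := memLp_id_gaussianReal (μ := 0) (v := v) p
  rw [← hv] at h
  exact (memLp_map_measure_iff (by fun_prop) (hG.measurable X hX).aemeasurable).1 h

theorem integral_eq_zero (hG : IsGaussianSpace P G) {X : Ω → ℝ} (hX : X ∈ G) :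
    ∫ ω, X ω ∂P = 0 := by
  obtain ⟨v, hv⟩ := hG.gaussian X hX
  have h := integral_id_gaussianReal (μ := 0) (v := v)
  rwa [← hv, integral_map (hG.measurable X hX).aemeasurable (by fun_prop)] at h

theorem integral_pow_four (hG : IsGaussianSpace P G) {X : Ω → ℝ} (hX : X ∈ G) :
    ∫ ω, X ω ^ 4 ∂P = 3 * (∫ ω, X ω ^ 2 ∂P) ^ 2 := by
  obtain ⟨v, hv⟩ := hG.gaussian X hX
  have hm := (hG.measurable X hX).aemeasurable (μ := P)
  have h4 := integral_pow_four_gaussianReal v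
  have h2 : ∫ x, x ^ 2 ∂gaussianReal 0 v = v := by
    have h := variance_fun_id_gaussianReal (μ := 0) (v := v)
    rwa [variance_of_integral_eq_zero (by fun_prop) (by simp)] at h
  rw [← hv, integral_map hm (by fun_prop)] at h2 h4
  rw [h2, h4]

theorem integrable_mul (hG : IsGaussianSpace P G) {X Y : Ω → ℝ} (hX : X ∈ G) (hY : Y ∈ G) :
    Integrable (fun ω => X ω * Y ω) P :=
  MemLp.integrable_mul (p := 2) (q := 2) (hG.memLp hX 2) (hG.memLp hY 2)

theorem memLp_sq (hG : IsGaussianSpace P G) {X : Ω → ℝ} (hX : X ∈ G) :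
    MemLp (fun ω => X ω ^ 2) 2 P := by
  have h4 := (hG.memLp hX 4).integrable_norm_pow (p := 4) (by norm_num)
  refine (memLp_two_iff_integrable_sq ((hG.measurable X hX).pow_const 2).aestronglyMeasurable).2 ?_
  refine h4.congr (.of_forall fun ω => ?_)
  simp only [Real.norm_eq_abs]
  rw [← pow_mul, (by decide : Even 4).pow_abs]

theorem integrable_sq_mul_sq (hG : IsGaussianSpace P G) {X Y : Ω → ℝ} (hX : X ∈ G) (hY : Y ∈ G) :
    Integrable (fun ω => X ω ^ 2 * Y ω ^ 2) P :=
  MemLp.integrable_mul (p := 2) (q := 2) (hG.memLp_sq hX) (hG.memLp_sq hY)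

theorem integrable_sq (hG : IsGaussianSpace P G) {X : Ω → ℝ} (hX : X ∈ G) :
    Integrable (fun ω => X ω ^ 2) P := by
  simpa only [sq] using hG.integrable_mul hX hX

theorem integrable_pow_four (hG : IsGaussianSpace P G) {X : Ω → ℝ} (hX : X ∈ G) :
    Integrable (fun ω => X ω ^ 4) P := by
  refine (hG.integrable_sq_mul_sq hX hX).congr (.of_forall fun ω => ?_)
  ring

/-- Isserlis' formula for `E[X² Y²]`. -/
theorem integral_sq_mul_sq (hG : IsGaussianSpace P G) {X Y : Ω → ℝ} (hX : X ∈ G) (hY : Y ∈ G) :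
    ∫ ω, X ω ^ 2 * Y ω ^ 2 ∂P =
      (∫ ω, X ω ^ 2 ∂P) * (∫ ω, Y ω ^ 2 ∂P) + 2 * (∫ ω, X ω * Y ω ∂P) ^ 2 := by
  have hp := hG.integral_pow_four (G.add_mem hX hY)
  have hm := hG.integral_pow_four (G.sub_mem hX hY)
  have hip := hG.integrable_pow_four (G.add_mem hX hY)
  have him := hG.integrable_pow_four (G.sub_mem hX hY)
  have hX4 := hG.integral_pow_four hX
  have hY4 := hG.integral_pow_four hY
  have hxy := hG.integrable_mul hX hY
  simp only [Pi.add_apply, Pi.sub_apply] at hp hm hip him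
  have e2p : ∫ ω, (X ω + Y ω) ^ 2 ∂P =
      (∫ ω, X ω ^ 2 ∂P) + 2 * (∫ ω, X ω * Y ω ∂P) + ∫ ω, Y ω ^ 2 ∂P := by
    have i : Integrable (fun ω => X ω ^ 2 + 2 * (X ω * Y ω)) P :=
      (hG.integrable_sq hX).add (hxy.const_mul 2)
    rw [← integral_const_mul, ← integral_add (hG.integrable_sq hX) (hxy.const_mul 2),
      ← integral_add i (hG.integrable_sq hY)]
    congr 1 with ω
    ring
  have e2m : ∫ ω, (X ω - Y ω) ^ 2 ∂P =
      (∫ ω, X ω ^ 2 ∂P) - 2 * (∫ ω, X ω * Y ω ∂P) + ∫ ω, Y ω ^ 2 ∂P := by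
    have i : Integrable (fun ω => X ω ^ 2 - 2 * (X ω * Y ω)) P :=
      (hG.integrable_sq hX).sub (hxy.const_mul 2)
    rw [← integral_const_mul, ← integral_sub (hG.integrable_sq hX) (hxy.const_mul 2),
      ← integral_add i (hG.integrable_sq hY)]
    congr 1 with ω
    ring
  have e4 : (∫ ω, (X ω + Y ω) ^ 4 ∂P) + ∫ ω, (X ω - Y ω) ^ 4 ∂P =
      2 * (∫ ω, X ω ^ 4 ∂P) + 12 * (∫ ω, X ω ^ 2 * Y ω ^ 2 ∂P) + 2 * ∫ ω, Y ω ^ 4 ∂P := by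
    have iX := (hG.integrable_pow_four hX).const_mul 2
    have iY := (hG.integrable_pow_four hY).const_mul 2
    have iXY := (hG.integrable_sq_mul_sq hX hY).const_mul 12
    have i : Integrable (fun ω => 2 * X ω ^ 4 + 12 * (X ω ^ 2 * Y ω ^ 2)) P := iX.add iXY
    rw [← integral_add hip him, ← integral_const_mul, ← integral_const_mul, ← integral_const_mul,
      ← integral_add iX iXY, ← integral_add i iY]
    congr 1 with ω
    ring
  rw [hp, hm, e2p, e2m, hX4, hY4] at e4
  linarith

end IsGaussianSpace
/-- Left Riemann sums of a continuous function on the unit interval converge to its integral. -/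
theorem tendsto_riemannSum {g : ℝ → ℝ} (hg : Continuous g) :
    Tendsto (fun m : ℕ => (1 / (m : ℝ)) * ∑ p ∈ Finset.range m, g ((p : ℝ) / m)) atTop
      (𝓝 (∫ x in (0 : ℝ)..1, g x)) := by
  rw [Metric.tendsto_atTop]
  intro ε hε
  have huc := isCompact_Icc.uniformContinuousOn_of_continuous (hg.continuousOn (s := Set.Icc 0 1))
  rw [Metric.uniformContinuousOn_iff] at huc
  obtain ⟨δ, hδ, hgδ⟩ := huc (ε / 2) (by linarith)
  obtain ⟨M, hM⟩ := exists_nat_one_div_lt hδ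
  refine ⟨M + 1, fun m hm => ?_⟩
  have hm0 : (0 : ℝ) < m := by
    have : 0 < m := by omega
    exact_mod_cast this
  have hmδ : 1 / (m : ℝ) < δ := by
    refine lt_of_le_of_lt ?_ hM
    apply one_div_le_one_div_of_le (by positivity)
    exact_mod_cast hm
  have hsum : ∫ x in (0 : ℝ)..1, g x =
      ∑ p ∈ Finset.range m, ∫ x in ((p : ℝ) / m)..(((p + 1 : ℕ) : ℝ) / m), g x := by
    rw [intervalIntegral.sum_integral_adjacent_intervals (a := fun p : ℕ => (p : ℝ) / m)
      (fun k _ => hg.intervalIntegrable _ _)]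
    simp [hm0.ne']
  have hterm : ∀ p ∈ Finset.range m, ‖(1 / (m : ℝ)) * g ((p : ℝ) / m) -
      ∫ x in ((p : ℝ) / m)..(((p + 1 : ℕ) : ℝ) / m), g x‖ ≤ ε / 2 * (1 / m) := by
    intro p hp
    have hpm : ((p + 1 : ℕ) : ℝ) ≤ m := by exact_mod_cast Finset.mem_range.1 hp
    have hlen : ((p + 1 : ℕ) : ℝ) / m - (p : ℝ) / m = 1 / m := by
      push_cast
      ring
    have hle : (p : ℝ) / m ≤ ((p + 1 : ℕ) : ℝ) / m := by
      have : 0 < 1 / (m : ℝ) := by positivity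
      linarith
    have hp0 : 0 ≤ (p : ℝ) / m := by positivity
    have hp1 : ((p + 1 : ℕ) : ℝ) / m ≤ 1 := (div_le_one hm0).2 hpm
    have hc : (1 / (m : ℝ)) * g ((p : ℝ) / m) =
        ∫ _ in ((p : ℝ) / m)..(((p + 1 : ℕ) : ℝ) / m), g ((p : ℝ) / m) := by
      rw [intervalIntegral.integral_const, hlen, smul_eq_mul]
    rw [hc, ← intervalIntegral.integral_sub intervalIntegrable_const (hg.intervalIntegrable _ _)]
    refine (intervalIntegral.norm_integral_le_of_norm_le_const (C := ε / 2) ?_).trans ?_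
    · intro x hx
      rw [Set.uIoc_of_le hle] at hx
      have := hgδ ((p : ℝ) / m) ⟨hp0, by linarith⟩ x ⟨by linarith [hx.1], by linarith [hx.2]⟩ (by
        rw [dist_comm, Real.dist_eq, abs_of_nonneg (by linarith [hx.1])]
        linarith [hx.2])
      rw [← dist_eq_norm]
      exact this.le
    · rw [hlen, abs_of_nonneg (by positivity)]
  rw [dist_eq_norm, hsum, Finset.mul_sum, ← Finset.sum_sub_distrib]
  refine (norm_sum_le_of_le _ hterm).trans_lt ?_
  rw [Finset.sum_const, Finset.card_range, nsmul_eq_mul]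
  have : (m : ℝ) * (ε / 2 * (1 / m)) = ε / 2 := by field_simp
  linarith

/-- Double sums of a function of the distance of the two indices. -/
theorem sum_sum_abs_sub (f : ℝ → ℝ) (m : ℕ) :
    ∑ p ∈ Finset.range m, ∑ q ∈ Finset.range m, f |(p : ℝ) - q| =
      2 * ∑ d ∈ Finset.range m, ((m : ℝ) - d) * f d - m * f 0 := by
  induction m with
  | zero => simp
  | succ m ih =>
    have hrow : ∑ q ∈ Finset.range m, f |(m : ℝ) - q| = ∑ d ∈ Finset.range m, f (d + 1) := by
      rw [← Finset.sum_range_reflect]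
      refine Finset.sum_congr rfl fun q hq => ?_
      have hq' := Finset.mem_range.1 hq
      congr 1
      have : (((m - 1 - q : ℕ) : ℝ)) = m - 1 - q := by
        rw [Nat.cast_sub (by omega), Nat.cast_sub (by omega)]
        simp
      rw [this, abs_of_nonneg]
      · ring
      · have : (0 : ℝ) ≤ q := by positivity
        linarith
    have hcol : ∑ q ∈ Finset.range m, f |(q : ℝ) - m| = ∑ d ∈ Finset.range m, f (d + 1) := by
      simp_rw [abs_sub_comm _ (m : ℝ)]
      exact hrow
    have hshift : ∑ d ∈ Finset.range m, f (d + 1) =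
        ∑ d ∈ Finset.range m, f d + f m - f 0 := by
      have h1 := Finset.sum_range_succ (fun d : ℕ => f d) m
      have h2 := Finset.sum_range_succ' (fun d : ℕ => f d) m
      push_cast at h1 h2
      linarith
    simp_rw [Finset.sum_range_succ _ m, Finset.sum_add_distrib]
    rw [hrow, hcol, ih, hshift]
    have hadd : ∑ d ∈ Finset.range m, (((m + 1 : ℕ) : ℝ) - d) * f d =
        ∑ d ∈ Finset.range m, ((m : ℝ) - d) * f d + ∑ d ∈ Finset.range m, f d := by
      rw [← Finset.sum_add_distrib]
      refine Finset.sum_congr rfl fun d _ => ?_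
      push_cast
      ring
    rw [hadd]
    push_cast
    simp
    ring

theorem sum_sum_abs_sub_le {f : ℝ → ℝ} (hf : ∀ d : ℕ, 0 ≤ f d) (m : ℕ) :
    ∑ p ∈ Finset.range m, ∑ q ∈ Finset.range m, f |(p : ℝ) - q| ≤
      2 * m * ∑ d ∈ Finset.range m, f d := by
  have h0 : 0 ≤ f 0 := by simpa using hf 0
  have h : ∑ d ∈ Finset.range m, ((m : ℝ) - d) * f d ≤ m * ∑ d ∈ Finset.range m, f d := by
    rw [Finset.mul_sum]
    refine Finset.sum_le_sum fun d _ => mul_le_mul_of_nonneg_right ?_ (hf d)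
    have : (0 : ℝ) ≤ d := by positivity
    linarith
  have hm : 0 ≤ (m : ℝ) * f 0 := by positivity
  rw [sum_sum_abs_sub]
  linarith

theorem sum_one_add_rpow_neg_le {β : ℝ} (hβ0 : 0 < β) (hβ1 : β < 1) (N : ℕ) :
    ∑ n ∈ Finset.range N, (1 + (n : ℝ)) ^ (-β) ≤ (N : ℝ) ^ (1 - β) / (1 - β) := by
  induction N with
  | zero => simp [Real.zero_rpow (by linarith : 1 - β ≠ 0)]
  | succ N ih =>
    rw [Finset.sum_range_succ]
    have hb : 0 < 1 - β := by linarith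
    have hN : (0 : ℝ) < N + 1 := by positivity
    have hbern := rpow_one_add_le_one_add_mul_self (s := -(1 / ((N : ℝ) + 1))) (by
      have : 1 / ((N : ℝ) + 1) ≤ 1 := by
        rw [div_le_one hN]
        linarith [(Nat.cast_nonneg N : (0 : ℝ) ≤ N)]
      linarith) hb.le (by linarith)
    have hN' : (N : ℝ) = (N + 1) * (1 + -(1 / ((N : ℝ) + 1))) := by
      field_simp
      ring
    have hnn : 0 ≤ 1 + -(1 / ((N : ℝ) + 1)) := by
      have : 1 / ((N : ℝ) + 1) ≤ 1 := by
        rw [div_le_one hN]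
        linarith [(Nat.cast_nonneg N : (0 : ℝ) ≤ N)]
      linarith
    have hpow : (N : ℝ) ^ (1 - β) ≤ ((N : ℝ) + 1) ^ (1 - β) - (1 - β) * (1 + (N : ℝ)) ^ (-β) := by
      calc (N : ℝ) ^ (1 - β)
          = ((N : ℝ) + 1) ^ (1 - β) * (1 + -(1 / ((N : ℝ) + 1))) ^ (1 - β) := by
            rw [← Real.mul_rpow hN.le hnn, ← hN']
        _ ≤ ((N : ℝ) + 1) ^ (1 - β) * (1 + (1 - β) * -(1 / ((N : ℝ) + 1))) := by gcongr
        _ = _ := by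
            rw [add_comm 1 (N : ℝ), (by ring : (1 - β) = -β + 1), Real.rpow_add_one hN.ne']
            field_simp
            ring
    have : (N : ℝ) ^ (1 - β) / (1 - β) ≤
        ((N : ℝ) + 1) ^ (1 - β) / (1 - β) - (1 + (N : ℝ)) ^ (-β) := by
      rw [div_le_iff₀ hb, sub_mul, div_mul_cancel₀ _ hb.ne']
      linarith
    push_cast
    linarith

/-- Polynomial decay is summable along geometric subsequences. -/
theorem summable_floor_pow_rpow_neg {β c : ℝ} (hβ : 0 < β) (hc : 1 < c) :
    Summable fun k : ℕ => ((⌊c ^ k⌋₊ : ℕ) : ℝ) ^ (-β) := by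
  have hc0 : 0 < c := by linarith
  have hgeo : Summable fun k : ℕ => (2 : ℝ) ^ β * (c ^ (-β)) ^ k :=
    (summable_geometric_of_lt_one (by positivity)
      (Real.rpow_lt_one_of_one_lt_of_neg hc (by linarith))).mul_left _
  refine Summable.of_nonneg_of_le (fun k => by positivity) (fun k => ?_) hgeo
  have h1 : 1 ≤ c ^ k := one_le_pow₀ hc.le
  have hfl : c ^ k / 2 ≤ (⌊c ^ k⌋₊ : ℕ) := by
    have h2 := Nat.lt_floor_add_one (c ^ k)
    have h3 : (1 : ℝ) ≤ (⌊c ^ k⌋₊ : ℕ) := by exact_mod_cast Nat.one_le_floor_iff _ |>.2 h1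
    linarith
  calc ((⌊c ^ k⌋₊ : ℕ) : ℝ) ^ (-β) ≤ (c ^ k / 2) ^ (-β) :=
        Real.rpow_le_rpow_of_nonpos (by positivity) hfl (by linarith)
    _ = 2 ^ β * (c ^ (-β)) ^ k := by
        rw [Real.div_rpow (by positivity) (by norm_num), Real.rpow_neg (by norm_num : (0:ℝ) ≤ 2),
          div_inv_eq_mul, mul_comm, ← Real.rpow_natCast, ← Real.rpow_mul hc0.le,
          ← Real.rpow_natCast, ← Real.rpow_mul hc0.le, mul_comm (k : ℝ)]
section StationaryGaussian

/-- Left Riemann sum with `m` nodes for `∫ x in 0..1, U (k + x)`. -/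
def riemannAverage (U : ℝ → Ω → ℝ) (m k : ℕ) : Ω → ℝ :=
  fun ω => (1 / (m : ℝ)) * ∑ p ∈ Finset.range m, U ((k : ℝ) + (p : ℝ) / m) ω

variable {P : Measure Ω} {G : Submodule ℝ (Ω → ℝ)} {U : ℝ → Ω → ℝ} {R : ℝ → ℝ}

theorem riemannAverage_mem {α : Type*} {G : Submodule ℝ (α → ℝ)} {U : ℝ → α → ℝ}
    (hU : ∀ s, 0 ≤ s → U s ∈ G) (m k : ℕ) :
    riemannAverage U m k ∈ G := by
  have h : riemannAverage U m k =
      (1 / (m : ℝ)) • ∑ p ∈ Finset.range m, U ((k : ℝ) + (p : ℝ) / m) := by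
    funext ω
    simp [riemannAverage]
  rw [h]
  exact G.smul_mem _ (G.sum_mem fun p _ => hU _ (by positivity))

theorem integral_riemannAverage_mul (hG : IsGaussianSpace P G) (hU : ∀ s, 0 ≤ s → U s ∈ G)
    (hcov : ∀ s t, 0 ≤ s → 0 ≤ t → ∫ ω, U s ω * U t ω ∂P = R |s - t|) (m k l : ℕ) :
    ∫ ω, riemannAverage U m k ω * riemannAverage U m l ω ∂P =
      (1 / (m : ℝ)) ^ 2 * ∑ p ∈ Finset.range m, ∑ q ∈ Finset.range m,
        R |(k : ℝ) + (p : ℝ) / m - ((l : ℝ) + (q : ℝ) / m)| := by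
  have h : ∀ ω, riemannAverage U m k ω * riemannAverage U m l ω =
      (1 / (m : ℝ)) ^ 2 * ∑ p ∈ Finset.range m, ∑ q ∈ Finset.range m,
        U ((k : ℝ) + (p : ℝ) / m) ω * U ((l : ℝ) + (q : ℝ) / m) ω := by
    intro ω
    rw [← Finset.sum_mul_sum]
    simp only [riemannAverage]
    ring
  have hUU : ∀ p q : ℕ, Integrable
      (fun ω => U ((k : ℝ) + (p : ℝ) / m) ω * U ((l : ℝ) + (q : ℝ) / m) ω) P := fun p q =>
    hG.integrable_mul (hU _ (by positivity)) (hU _ (by positivity))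
  simp_rw [h]
  rw [integral_const_mul, integral_finsetSum _ fun p _ => integrable_finsetSum _ fun q _ => hUU p q]
  congr 1
  refine Finset.sum_congr rfl fun p _ => ?_
  rw [integral_finsetSum _ fun q _ => hUU p q]
  exact Finset.sum_congr rfl fun q _ => hcov _ _ (by positivity) (by positivity)

theorem integral_riemannAverage_sq (hG : IsGaussianSpace P G) (hU : ∀ s, 0 ≤ s → U s ∈ G)
    (hcov : ∀ s t, 0 ≤ s → 0 ≤ t → ∫ ω, U s ω * U t ω ∂P = R |s - t|) (m k : ℕ) :
    ∫ ω, riemannAverage U m k ω ^ 2 ∂P =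
      2 * ((1 / (m : ℝ)) * ∑ d ∈ Finset.range m, (1 - (d : ℝ) / m) * R ((d : ℝ) / m)) -
        1 / (m : ℝ) * R 0 := by
  rcases Nat.eq_zero_or_pos m with rfl | hm
  · simp [riemannAverage]
  have hm0 : (0 : ℝ) < m := by exact_mod_cast hm
  have h := integral_riemannAverage_mul hG hU hcov m k k
  have e : ∀ p q : ℕ, R |(k : ℝ) + (p : ℝ) / m - ((k : ℝ) + (q : ℝ) / m)| =
      (fun x => R (x / m)) |(p : ℝ) - q| := by
    intro p q
    simp only
    congr 1
    rw [add_sub_add_left_eq_sub, ← sub_div, abs_div, abs_of_pos hm0]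
  simp_rw [e] at h
  rw [sum_sum_abs_sub (fun x => R (x / m))] at h
  simp_rw [sq (riemannAverage U m k _)]
  rw [h]
  have e2 : ∑ d ∈ Finset.range m, ((m : ℝ) - d) * R ((d : ℝ) / m) =
      m * ∑ d ∈ Finset.range m, (1 - (d : ℝ) / m) * R ((d : ℝ) / m) := by
    rw [Finset.mul_sum]
    refine Finset.sum_congr rfl fun d _ => ?_
    field_simp
  rw [e2, zero_div]
  field_simp

theorem tendsto_integral_riemannAverage_sq (hG : IsGaussianSpace P G)
    (hU : ∀ s, 0 ≤ s → U s ∈ G)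
    (hcov : ∀ s t, 0 ≤ s → 0 ≤ t → ∫ ω, U s ω * U t ω ∂P = R |s - t|) (hR : Continuous R) (k : ℕ) :
    Tendsto (fun m => ∫ ω, riemannAverage U m k ω ^ 2 ∂P) atTop
      (𝓝 (2 * ∫ x in (0 : ℝ)..1, (1 - x) * R x)) := by
  simp_rw [integral_riemannAverage_sq hG hU hcov]
  have h1 := (tendsto_riemannSum (g := fun x => (1 - x) * R x) (by fun_prop)).const_mul 2
  have h2 := (tendsto_one_div_atTop_nhds_zero_nat (𝕜 := ℝ)).mul_const (R 0)
  simpa using h1.sub h2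

theorem abs_integral_riemannAverage_mul_le (hG : IsGaussianSpace P G)
    (hU : ∀ s, 0 ≤ s → U s ∈ G)
    (hcov : ∀ s t, 0 ≤ s → 0 ≤ t → ∫ ω, U s ω * U t ω ∂P = R |s - t|)
    {C β : ℝ} (hC : 0 ≤ C) (hβ : 0 ≤ β) (hdecay : ∀ x, 0 ≤ x → |R x| ≤ C * (1 + x) ^ (-β))
    (m k l : ℕ) :
    |∫ ω, riemannAverage U m k ω * riemannAverage U m l ω ∂P| ≤
      C * 2 ^ β * (1 + |(k : ℝ) - l|) ^ (-β) := by
  rcases Nat.eq_zero_or_pos m with rfl | hm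
  · simp only [riemannAverage]
    simp
    positivity
  have hm0 : (0 : ℝ) < m := by exact_mod_cast hm
  rw [integral_riemannAverage_mul hG hU hcov, abs_mul, abs_of_nonneg (by positivity)]
  have hterm : ∀ p ∈ Finset.range m, ∀ q ∈ Finset.range m,
      |R (|(k : ℝ) + (p : ℝ) / m - ((l : ℝ) + (q : ℝ) / m)|)| ≤
        C * 2 ^ β * (1 + |(k : ℝ) - l|) ^ (-β) := by
    intro p hp q hq
    have hp1 : (p : ℝ) / m ≤ 1 := by
      rw [div_le_one hm0]
      exact_mod_cast (Finset.mem_range.1 hp).le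
    have hq1 : (q : ℝ) / m ≤ 1 := by
      rw [div_le_one hm0]
      exact_mod_cast (Finset.mem_range.1 hq).le
    have hp0 : 0 ≤ (p : ℝ) / m := by positivity
    have hq0 : 0 ≤ (q : ℝ) / m := by positivity
    have hx : (1 + |(k : ℝ) - l|) / 2 ≤
        1 + |(k : ℝ) + (p : ℝ) / m - ((l : ℝ) + (q : ℝ) / m)| := by
      have ht := abs_sub_abs_le_abs_sub ((k : ℝ) - l) ((q : ℝ) / m - (p : ℝ) / m)
      have hpq : |(q : ℝ) / m - (p : ℝ) / m| ≤ 1 := abs_le.2 ⟨by linarith, by linarith⟩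
      have he : (k : ℝ) - l - ((q : ℝ) / m - (p : ℝ) / m) =
          (k : ℝ) + (p : ℝ) / m - ((l : ℝ) + (q : ℝ) / m) := by ring
      rw [he] at ht
      have h0 := abs_nonneg ((k : ℝ) + (p : ℝ) / m - ((l : ℝ) + (q : ℝ) / m))
      linarith
    have hpow : ((1 + |(k : ℝ) - l|) / 2) ^ (-β) = 2 ^ β * (1 + |(k : ℝ) - l|) ^ (-β) := by
      rw [Real.div_rpow (by positivity) (by norm_num), Real.rpow_neg (by norm_num : (0 : ℝ) ≤ 2),
        div_inv_eq_mul, mul_comm]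
    calc |R (|(k : ℝ) + (p : ℝ) / m - ((l : ℝ) + (q : ℝ) / m)|)|
        ≤ C * (1 + |(k : ℝ) + (p : ℝ) / m - ((l : ℝ) + (q : ℝ) / m)|) ^ (-β) :=
          hdecay _ (abs_nonneg _)
      _ ≤ C * ((1 + |(k : ℝ) - l|) / 2) ^ (-β) := by
          refine mul_le_mul_of_nonneg_left ?_ hC
          exact Real.rpow_le_rpow_of_nonpos (by positivity) hx (by linarith)
      _ = _ := by rw [hpow, mul_assoc]
  have hsum : |∑ p ∈ Finset.range m, ∑ q ∈ Finset.range m,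
        R (|(k : ℝ) + (p : ℝ) / m - ((l : ℝ) + (q : ℝ) / m)|)| ≤
      ∑ p ∈ Finset.range m, ∑ q ∈ Finset.range m,
        C * 2 ^ β * (1 + |(k : ℝ) - l|) ^ (-β) :=
    (Finset.abs_sum_le_sum_abs _ _).trans (Finset.sum_le_sum fun p hp =>
      (Finset.abs_sum_le_sum_abs _ _).trans (Finset.sum_le_sum fun q hq => hterm p hp q hq))
  calc _ ≤ (1 / (m : ℝ)) ^ 2 * ∑ p ∈ Finset.range m, ∑ q ∈ Finset.range m,
        C * 2 ^ β * (1 + |(k : ℝ) - l|) ^ (-β) := by gcongr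
    _ = _ := by
        simp only [Finset.sum_const, Finset.card_range, nsmul_eq_mul]
        field_simp

/-- Mean square error of the empirical second moment of a Gaussian family. -/
theorem IsGaussianSpace.integral_sq_empirical_sub [IsProbabilityMeasure P]
    (hG : IsGaussianSpace P G)
    {Z : ℕ → Ω → ℝ} (hZ : ∀ k, Z k ∈ G) {v : ℝ} (hv : ∀ k, ∫ ω, Z k ω ^ 2 ∂P = v) (s : ℝ)
    {N : ℕ} (hN : 0 < N) :
    ∫ ω, ((1 / (N : ℝ)) * ∑ k ∈ Finset.range N, Z k ω ^ 2 - s) ^ 2 ∂P =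
      (v - s) ^ 2 + 2 * (1 / (N : ℝ)) ^ 2 * ∑ k ∈ Finset.range N, ∑ l ∈ Finset.range N,
        (∫ ω, Z k ω * Z l ω ∂P) ^ 2 := by
  have hN0 : (0 : ℝ) < N := by exact_mod_cast hN
  have hexp : ∀ ω, ((1 / (N : ℝ)) * ∑ k ∈ Finset.range N, Z k ω ^ 2 - s) ^ 2 =
      (1 / (N : ℝ)) ^ 2 * ∑ k ∈ Finset.range N, ∑ l ∈ Finset.range N,
        (Z k ω ^ 2 * Z l ω ^ 2 - s * Z k ω ^ 2 - s * Z l ω ^ 2 + s ^ 2) := by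
    intro ω
    have h1 : (1 / (N : ℝ)) * ∑ k ∈ Finset.range N, Z k ω ^ 2 - s =
        (1 / (N : ℝ)) * ∑ k ∈ Finset.range N, (Z k ω ^ 2 - s) := by
      rw [Finset.sum_sub_distrib]
      simp
      field_simp
    rw [h1, mul_pow, sq (∑ k ∈ Finset.range N, (Z k ω ^ 2 - s)), Finset.sum_mul_sum]
    congr 1
    refine Finset.sum_congr rfl fun k _ => Finset.sum_congr rfl fun l _ => ?_
    ring
  have i1 := fun k l => hG.integrable_sq_mul_sq (hZ k) (hZ l)
  have i2 := fun k => (hG.integrable_sq (hZ k)).const_mul s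
  have i3 : ∀ k l, Integrable (fun ω => Z k ω ^ 2 * Z l ω ^ 2 - s * Z k ω ^ 2) P :=
    fun k l => (i1 k l).sub (i2 k)
  have i4 : ∀ k l, Integrable
      (fun ω => Z k ω ^ 2 * Z l ω ^ 2 - s * Z k ω ^ 2 - s * Z l ω ^ 2) P :=
    fun k l => (i3 k l).sub (i2 l)
  have i5 : ∀ k l, Integrable
      (fun ω => Z k ω ^ 2 * Z l ω ^ 2 - s * Z k ω ^ 2 - s * Z l ω ^ 2 + s ^ 2) P :=
    fun k l => (i4 k l).add (integrable_const _)
  have hterm : ∀ k l,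
      ∫ ω, (Z k ω ^ 2 * Z l ω ^ 2 - s * Z k ω ^ 2 - s * Z l ω ^ 2 + s ^ 2) ∂P =
        (v - s) ^ 2 + 2 * (∫ ω, Z k ω * Z l ω ∂P) ^ 2 := by
    intro k l
    rw [integral_add (i4 k l) (integrable_const _), integral_sub (i3 k l) (i2 l),
      integral_sub (i1 k l) (i2 k), integral_const_mul, integral_const_mul,
      hG.integral_sq_mul_sq (hZ k) (hZ l), hv, hv]
    simp
    ring
  simp_rw [hexp]
  rw [integral_const_mul, integral_finsetSum _ fun k _ => integrable_finsetSum _ fun l _ => i5 k l]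
  have hrow : ∀ k, ∫ ω, ∑ l ∈ Finset.range N,
      (Z k ω ^ 2 * Z l ω ^ 2 - s * Z k ω ^ 2 - s * Z l ω ^ 2 + s ^ 2) ∂P =
      N * (v - s) ^ 2 + 2 * ∑ l ∈ Finset.range N, (∫ ω, Z k ω * Z l ω ∂P) ^ 2 := by
    intro k
    rw [integral_finsetSum _ fun l _ => i5 k l]
    simp_rw [hterm]
    rw [Finset.sum_add_distrib, Finset.mul_sum]
    simp
  simp_rw [hrow]
  rw [Finset.sum_add_distrib]
  simp only [Finset.sum_const, Finset.card_range, nsmul_eq_mul]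
  field_simp
  rw [Finset.mul_sum]

theorem integral_sq_empirical_riemannAverage_le [IsProbabilityMeasure P]
    (hG : IsGaussianSpace P G) (hU : ∀ s, 0 ≤ s → U s ∈ G)
    (hcov : ∀ s t, 0 ≤ s → 0 ≤ t → ∫ ω, U s ω * U t ω ∂P = R |s - t|)
    {C β : ℝ} (hC : 0 ≤ C) (hβ0 : 0 < β) (hβ1 : 2 * β < 1)
    (hdecay : ∀ x, 0 ≤ x → |R x| ≤ C * (1 + x) ^ (-β)) (s : ℝ) (m : ℕ) {N : ℕ} (hN : 0 < N) :
    ∫ ω, ((1 / (N : ℝ)) * ∑ k ∈ Finset.range N, riemannAverage U m k ω ^ 2 - s) ^ 2 ∂P ≤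
      ((∫ ω, riemannAverage U m 0 ω ^ 2 ∂P) - s) ^ 2 +
        4 * (C * 2 ^ β) ^ 2 / (1 - 2 * β) * (N : ℝ) ^ (-(2 * β)) := by
  have hN0 : (0 : ℝ) < N := by exact_mod_cast hN
  rw [hG.integral_sq_empirical_sub (riemannAverage_mem hU m) (fun k => by
    rw [integral_riemannAverage_sq hG hU hcov m k, ← integral_riemannAverage_sq hG hU hcov m 0])
    s hN]
  have hterm : ∀ k l : ℕ, (∫ ω, riemannAverage U m k ω * riemannAverage U m l ω ∂P) ^ 2 ≤
      (C * 2 ^ β) ^ 2 * (1 + |(k : ℝ) - l|) ^ (-(2 * β)) := by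
    intro k l
    have h := abs_integral_riemannAverage_mul_le hG hU hcov hC hβ0.le hdecay m k l
    rw [← sq_abs]
    refine (pow_le_pow_left₀ (abs_nonneg _) h 2).trans_eq ?_
    rw [mul_pow, ← Real.rpow_natCast ((1 + |(k : ℝ) - l|) ^ (-β)), ← Real.rpow_mul (by positivity)]
    congr 2
    push_cast
    ring
  have hsum : ∑ k ∈ Finset.range N, ∑ l ∈ Finset.range N,
      (∫ ω, riemannAverage U m k ω * riemannAverage U m l ω ∂P) ^ 2 ≤
      (C * 2 ^ β) ^ 2 * (2 * N * ((N : ℝ) ^ (1 - 2 * β) / (1 - 2 * β))) := by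
    calc _ ≤ ∑ k ∈ Finset.range N, ∑ l ∈ Finset.range N,
          (C * 2 ^ β) ^ 2 * (1 + |(k : ℝ) - l|) ^ (-(2 * β)) :=
          Finset.sum_le_sum fun k _ => Finset.sum_le_sum fun l _ => hterm k l
      _ = (C * 2 ^ β) ^ 2 * ∑ k ∈ Finset.range N, ∑ l ∈ Finset.range N,
          (fun x => (1 + x) ^ (-(2 * β))) |(k : ℝ) - l| := by
          simp_rw [Finset.mul_sum]
      _ ≤ (C * 2 ^ β) ^ 2 * (2 * N * ∑ d ∈ Finset.range N, (1 + (d : ℝ)) ^ (-(2 * β))) := by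
          gcongr
          exact sum_sum_abs_sub_le (f := fun x => (1 + x) ^ (-(2 * β)))
            (fun d => by positivity) N
      _ ≤ _ := by
          gcongr
          exact sum_one_add_rpow_neg_le (by linarith) hβ1 N
  have hpow : (N : ℝ) ^ (1 - 2 * β) = N * (N : ℝ) ^ (-(2 * β)) := by
    rw [sub_eq_add_neg, Real.rpow_one_add' hN0.le (by linarith)]
  calc _ ≤ ((∫ ω, riemannAverage U m 0 ω ^ 2 ∂P) - s) ^ 2 + 2 * (1 / (N : ℝ)) ^ 2 *
        ((C * 2 ^ β) ^ 2 * (2 * N * ((N : ℝ) ^ (1 - 2 * β) / (1 - 2 * β)))) := by gcongr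
    _ = _ := by
        have : 1 - 2 * β ≠ 0 := by linarith
        rw [hpow]
        field_simp
        ring

theorem ae_tendsto_riemannAverage (hcont : ∀ᵐ ω ∂P, Continuous fun t => U t ω) :
    ∀ᵐ ω ∂P, ∀ k : ℕ, Tendsto (fun m => riemannAverage U m k ω) atTop
      (𝓝 (∫ x in (0 : ℝ)..1, U (k + x) ω)) := by
  filter_upwards [hcont] with ω hω k
  exact tendsto_riemannSum (g := fun x => U (k + x) ω) (hω.comp (continuous_const_add _))

theorem ae_tendsto_sq_empirical_riemannAverage (hcont : ∀ᵐ ω ∂P, Continuous fun t => U t ω)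
    (s : ℝ) (N : ℕ) :
    ∀ᵐ ω ∂P, Tendsto (fun m => ENNReal.ofReal
        (((1 / (N : ℝ)) * ∑ k ∈ Finset.range N, riemannAverage U m k ω ^ 2 - s) ^ 2)) atTop
      (𝓝 (ENNReal.ofReal (((1 / (N : ℝ)) *
        ∑ k ∈ Finset.range N, (∫ x in (0 : ℝ)..1, U (k + x) ω) ^ 2 - s) ^ 2))) := by
  filter_upwards [ae_tendsto_riemannAverage hcont] with ω hω
  refine ENNReal.tendsto_ofReal (((Tendsto.const_mul _ ?_).sub_const s).pow 2)
  exact tendsto_finsetSum _ fun k _ => (hω k).pow 2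

theorem measurable_sq_empirical_riemannAverage (hG : IsGaussianSpace P G)
    (hU : ∀ s, 0 ≤ s → U s ∈ G) (s : ℝ) (N m : ℕ) :
    Measurable fun ω => ENNReal.ofReal
      (((1 / (N : ℝ)) * ∑ k ∈ Finset.range N, riemannAverage U m k ω ^ 2 - s) ^ 2) := by
  refine ENNReal.measurable_ofReal.comp (((Measurable.const_mul ?_ _).sub_const s).pow_const 2)
  exact Finset.measurable_fun_sum _ fun k _ =>
    (hG.measurable _ (riemannAverage_mem hU m k)).pow_const 2

theorem lintegral_sq_empirical_integral_le [IsProbabilityMeasure P]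
    (hG : IsGaussianSpace P G) (hU : ∀ s, 0 ≤ s → U s ∈ G)
    (hcov : ∀ s t, 0 ≤ s → 0 ≤ t → ∫ ω, U s ω * U t ω ∂P = R |s - t|)
    (hcont : ∀ᵐ ω ∂P, Continuous fun t => U t ω) (hR : Continuous R)
    {C β : ℝ} (hC : 0 ≤ C) (hβ0 : 0 < β) (hβ1 : 2 * β < 1)
    (hdecay : ∀ x, 0 ≤ x → |R x| ≤ C * (1 + x) ^ (-β)) {N : ℕ} (hN : 0 < N) :
    ∫⁻ ω, ENNReal.ofReal (((1 / (N : ℝ)) *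
        ∑ k ∈ Finset.range N, (∫ x in (0 : ℝ)..1, U (k + x) ω) ^ 2 -
          2 * ∫ x in (0 : ℝ)..1, (1 - x) * R x) ^ 2) ∂P ≤
      ENNReal.ofReal (4 * (C * 2 ^ β) ^ 2 / (1 - 2 * β) * (N : ℝ) ^ (-(2 * β))) := by
  set s := 2 * ∫ x in (0 : ℝ)..1, (1 - x) * R x with hs
  set K := 4 * (C * 2 ^ β) ^ 2 / (1 - 2 * β) * (N : ℝ) ^ (-(2 * β))
  have hUU : ∀ m, Integrable (fun ω =>
      ((1 / (N : ℝ)) * ∑ k ∈ Finset.range N, riemannAverage U m k ω ^ 2 - s) ^ 2) P := by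
    intro m
    refine MemLp.integrable_sq (MemLp.sub (MemLp.const_mul ?_ _) (memLp_const s))
    exact memLp_finsetSum _ fun k _ => hG.memLp_sq (riemannAverage_mem hU m k)
  have hlim : Tendsto (fun m => ENNReal.ofReal
      (((∫ ω, riemannAverage U m 0 ω ^ 2 ∂P) - s) ^ 2 + K)) atTop (𝓝 (ENNReal.ofReal K)) := by
    refine ENNReal.tendsto_ofReal ?_
    have h := (((tendsto_integral_riemannAverage_sq hG hU hcov hR 0).sub_const s).pow 2).add_const K
    rw [← hs] at h
    simpa using h
  calc _ = ∫⁻ ω, liminf (fun m => ENNReal.ofReal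
        (((1 / (N : ℝ)) * ∑ k ∈ Finset.range N, riemannAverage U m k ω ^ 2 - s) ^ 2)) atTop ∂P := by
        refine lintegral_congr_ae ?_
        filter_upwards [ae_tendsto_sq_empirical_riemannAverage hcont s N] with ω hω
        exact hω.liminf_eq.symm
    _ ≤ liminf (fun m => ∫⁻ ω, ENNReal.ofReal
        (((1 / (N : ℝ)) * ∑ k ∈ Finset.range N, riemannAverage U m k ω ^ 2 - s) ^ 2) ∂P) atTop :=
        lintegral_liminf_le fun m => measurable_sq_empirical_riemannAverage hG hU s N m
    _ ≤ liminf (fun m => ENNReal.ofReal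
      (((∫ ω, riemannAverage U m 0 ω ^ 2 ∂P) - s) ^ 2 + K)) atTop := by
        refine liminf_le_liminf (.of_forall fun m => ?_)
        rw [← ofReal_integral_eq_lintegral_ofReal (hUU m) (.of_forall fun ω => sq_nonneg _)]
        exact ENNReal.ofReal_le_ofReal
          (integral_sq_empirical_riemannAverage_le hG hU hcov hC hβ0 hβ1 hdecay s m hN)
    _ = _ := hlim.liminf_eq

/-- Strong law of large numbers for the squares of the unit-window averages of a stationary
Gaussian process with continuous paths and polynomially decaying correlations. -/
theorem ae_tendsto_empirical_sq_integral [IsProbabilityMeasure P]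
    (hG : IsGaussianSpace P G) (hU : ∀ s, 0 ≤ s → U s ∈ G)
    (hcov : ∀ s t, 0 ≤ s → 0 ≤ t → ∫ ω, U s ω * U t ω ∂P = R |s - t|)
    (hcont : ∀ᵐ ω ∂P, Continuous fun t => U t ω) (hR : Continuous R)
    {C β : ℝ} (hC : 0 ≤ C) (hβ0 : 0 < β) (hβ1 : 2 * β < 1)
    (hdecay : ∀ x, 0 ≤ x → |R x| ≤ C * (1 + x) ^ (-β)) :
    ∀ᵐ ω ∂P, Tendsto (fun N : ℕ => (1 / (N : ℝ)) *
        ∑ k ∈ Finset.range N, (∫ x in (0 : ℝ)..1, U (k + x) ω) ^ 2) atTop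
      (𝓝 (2 * ∫ x in (0 : ℝ)..1, (1 - x) * R x)) := by
  set s := 2 * ∫ x in (0 : ℝ)..1, (1 - x) * R x with hs
  set Q : ℕ → Ω → ℝ := fun N ω => (1 / (N : ℝ)) *
    ∑ k ∈ Finset.range N, (∫ x in (0 : ℝ)..1, U (k + x) ω) ^ 2 with hQ
  have hsub : ∀ c : ℝ, 1 < c → ∀ᵐ ω ∂P, Tendsto (fun n : ℕ => Q ⌊c ^ n⌋₊ ω) atTop (𝓝 s) := by
    intro c hc
    have hsum : ∑' n : ℕ, ∫⁻ ω, ENNReal.ofReal ((Q ⌊c ^ n⌋₊ ω - s) ^ 2) ∂P ≠ ⊤ := by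
      have hs' := (summable_floor_pow_rpow_neg (β := 2 * β) (by linarith) hc).mul_left
        (4 * (C * 2 ^ β) ^ 2 / (1 - 2 * β))
      refine ne_top_of_le_ne_top hs'.tsum_ofReal_ne_top (ENNReal.tsum_le_tsum fun n => ?_)
      exact lintegral_sq_empirical_integral_le hG hU hcov hcont hR hC hβ0 hβ1 hdecay
        (Nat.floor_pos.2 (one_le_pow₀ hc.le))
    have hmeas : ∀ n : ℕ, AEMeasurable (fun ω => ENNReal.ofReal ((Q ⌊c ^ n⌋₊ ω - s) ^ 2)) P :=
      fun n => aemeasurable_of_tendsto_metrizable_ae atTop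
        (fun m => (measurable_sq_empirical_riemannAverage hG hU s _ m).aemeasurable)
        (ae_tendsto_sq_empirical_riemannAverage hcont s _)
    rw [← lintegral_tsum hmeas] at hsum
    filter_upwards [ae_lt_top' (.tsum hmeas) hsum] with ω hω
    have h0 := ENNReal.tendsto_atTop_zero_of_tsum_ne_top hω.ne
    have h1 := (ENNReal.tendsto_toReal ENNReal.zero_ne_top).comp h0
    have h2 : Tendsto (fun n : ℕ => (Q ⌊c ^ n⌋₊ ω - s) ^ 2) atTop (𝓝 0) := by
      refine h1.congr fun n => ?_
      simp [ENNReal.toReal_ofReal (sq_nonneg _)]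
    have h3 := h2.sqrt
    simp only [Real.sqrt_sq_eq_abs, Real.sqrt_zero] at h3
    have h4 := (tendsto_zero_iff_abs_tendsto_zero _).2 h3
    simpa using h4.add_const s
  have hall : ∀ᵐ ω ∂P, ∀ j : ℕ, Tendsto
      (fun n : ℕ => Q ⌊(1 + 1 / ((j : ℝ) + 1)) ^ n⌋₊ ω) atTop (𝓝 s) :=
    ae_all_iff.2 fun j => hsub _ (by
      have : 0 < 1 / ((j : ℝ) + 1) := by positivity
      linarith)
  filter_upwards [hall] with ω hω
  have h := tendsto_div_of_monotone_of_tendsto_div_floor_pow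
    (fun N => ∑ k ∈ Finset.range N, (∫ x in (0 : ℝ)..1, U (k + x) ω) ^ 2) s
    (fun M N hMN => Finset.sum_le_sum_of_subset_of_nonneg (Finset.range_mono hMN)
      fun _ _ _ => sq_nonneg _)
    (fun j : ℕ => 1 + 1 / ((j : ℝ) + 1))
    (fun j => by
      have : 0 < 1 / ((j : ℝ) + 1) := by positivity
      linarith)
    (by simpa using tendsto_one_div_add_atTop_nhds_zero_nat (𝕜 := ℝ) |>.const_add 1)
    (fun j => by
      refine (hω j).congr fun n => ?_
      simp only [hQ]
      ring)
  refine h.congr fun N => ?_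
  ring

end StationaryGaussian

/-- Autocovariance at lag `x` of the unit increments of a fractional Brownian motion. -/
def fgnCov (H x : ℝ) : ℝ := (|x + 1| ^ (2 * H) + |x - 1| ^ (2 * H) - 2 * |x| ^ (2 * H)) / 2

theorem continuous_fgnCov {H : ℝ} (hH : 0 < H) : Continuous (fgnCov H) := by
  have h : ∀ c : ℝ, Continuous fun x : ℝ => |x + c| ^ (2 * H) := fun c =>
    (continuous_abs.comp (continuous_add_const c)).rpow_const fun _ => Or.inr (by linarith)
  have h0 := h 0
  simp only [add_zero] at h0
  exact (((h 1).add (h (-1))).sub (h0.const_mul 2)).div_const 2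

theorem fgnCov_abs (H x : ℝ) : fgnCov H |x| = fgnCov H x := by
  rcases abs_choice x with h | h
  · rw [h]
  · have h1 : |-x + 1| = |x - 1| := by rw [← abs_neg (x - 1)]; ring_nf
    have h2 : |-x - 1| = |x + 1| := by rw [← abs_neg (x + 1)]; ring_nf
    rw [h, fgnCov, fgnCov, h1, h2, abs_neg]
    ring

theorem abs_rpow_add_one_sub_rpow_le {r t : ℝ} (hr0 : -1 < r) (hr1 : r < 1) (ht : 0 < t) :
    |(t + 1) ^ r - t ^ r| ≤ t ^ (r - 1) := by
  have hd : ∀ y ∈ Set.Icc t (t + 1),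
      HasDerivWithinAt (fun y : ℝ => y ^ r) (r * y ^ (r - 1)) (Set.Icc t (t + 1)) y :=
    fun y hy => (Real.hasDerivAt_rpow_const (Or.inl (by linarith [hy.1]))).hasDerivWithinAt
  have hb : ∀ y ∈ Set.Icc t (t + 1), ‖r * y ^ (r - 1)‖ ≤ t ^ (r - 1) := by
    intro y hy
    have hy0 : 0 < y := by linarith [hy.1]
    rw [norm_mul, Real.norm_eq_abs, Real.norm_eq_abs, abs_of_nonneg (by positivity : 0 ≤ y ^ (r - 1))]
    have h1 : |r| ≤ 1 := abs_le.2 ⟨hr0.le, hr1.le⟩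
    have h2 := Real.rpow_le_rpow_of_nonpos ht hy.1 (by linarith : r - 1 ≤ 0)
    calc |r| * y ^ (r - 1) ≤ 1 * t ^ (r - 1) := by gcongr
      _ = _ := one_mul _
  have h := (convex_Icc t (t + 1)).norm_image_sub_le_of_norm_hasDerivWithin_le hd hb
    (Set.left_mem_Icc.2 (by linarith)) (Set.right_mem_Icc.2 (by linarith))
  simpa using h

theorem abs_second_difference_rpow_le {q x : ℝ} (hq0 : 0 < q) (hq2 : q < 2) (hx : 1 < x) :
    |(x + 1) ^ q + (x - 1) ^ q - 2 * x ^ q| ≤ 2 * (x - 1) ^ (q - 2) := by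
  have hd : ∀ y ∈ Set.Icc x (x + 1), HasDerivWithinAt (fun y : ℝ => y ^ q - (y - 1) ^ q)
      (q * y ^ (q - 1) - q * (y - 1) ^ (q - 1)) (Set.Icc x (x + 1)) y := by
    intro y hy
    have h1 : HasDerivAt (fun y : ℝ => y ^ q) (q * y ^ (q - 1)) y :=
      Real.hasDerivAt_rpow_const (Or.inl (by linarith [hy.1]))
    have h2 : HasDerivAt (fun y : ℝ => (y - 1) ^ q) (q * (y - 1) ^ (q - 1)) y :=
      HasDerivAt.comp_sub_const y 1 (Real.hasDerivAt_rpow_const (Or.inl (by linarith [hy.1])))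
    exact (h1.sub h2).hasDerivWithinAt
  have hb : ∀ y ∈ Set.Icc x (x + 1),
      ‖q * y ^ (q - 1) - q * (y - 1) ^ (q - 1)‖ ≤ 2 * (x - 1) ^ (q - 2) := by
    intro y hy
    have h1 := abs_rpow_add_one_sub_rpow_le (r := q - 1) (t := y - 1) (by linarith) (by linarith)
      (by linarith [hy.1])
    rw [sub_add_cancel, (by ring : q - 1 - 1 = q - 2)] at h1
    have h2 : (y - 1) ^ (q - 2) ≤ (x - 1) ^ (q - 2) :=
      Real.rpow_le_rpow_of_nonpos (by linarith) (by linarith [hy.1]) (by linarith)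
    rw [← mul_sub, norm_mul, Real.norm_eq_abs, Real.norm_eq_abs, abs_of_pos hq0]
    have h3 := h1.trans h2
    gcongr
  have h := (convex_Icc x (x + 1)).norm_image_sub_le_of_norm_hasDerivWithin_le hd hb
    (Set.left_mem_Icc.2 (by linarith)) (Set.right_mem_Icc.2 (by linarith))
  have e : (x + 1) ^ q + (x - 1) ^ q - 2 * x ^ q =
      (x + 1) ^ q - (x + 1 - 1) ^ q - (x ^ q - (x - 1) ^ q) := by
    rw [add_sub_cancel_right]
    ring
  rw [e]
  simpa using h

theorem abs_fgnCov_le {H : ℝ} (hH0 : 0 < H) (hH1 : H < 1) {x : ℝ} (hx : 0 ≤ x) :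
    |fgnCov H x| ≤ 81 * (1 + x) ^ (-(2 - 2 * H)) := by
  have hx1 : 0 < 1 + x := by linarith
  rcases le_or_gt 2 x with h2 | h2
  · have h := abs_second_difference_rpow_le (q := 2 * H) (by linarith) (by linarith)
      (by linarith : 1 < x)
    have h3 : (x - 1) ^ (2 * H - 2) ≤ 81 * (1 + x) ^ (-(2 - 2 * H)) := by
      calc (x - 1) ^ (2 * H - 2) ≤ ((1 + x) / 3) ^ (2 * H - 2) :=
            Real.rpow_le_rpow_of_nonpos (by positivity) (by linarith) (by linarith)
        _ = 3 ^ (2 - 2 * H) * (1 + x) ^ (-(2 - 2 * H)) := by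
            rw [Real.div_rpow hx1.le (by norm_num), (by ring : 2 * H - 2 = -(2 - 2 * H)),
              Real.rpow_neg (by norm_num : (0 : ℝ) ≤ 3), div_inv_eq_mul, mul_comm]
        _ ≤ 81 * (1 + x) ^ (-(2 - 2 * H)) := by
            gcongr
            calc (3 : ℝ) ^ (2 - 2 * H) ≤ 3 ^ (2 : ℝ) :=
                  Real.rpow_le_rpow_of_exponent_le (by norm_num) (by linarith)
              _ ≤ 81 := by norm_num
    rw [fgnCov, abs_of_pos (by linarith : 0 < x + 1), abs_of_pos (by linarith : 0 < x - 1),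
      abs_of_nonneg hx, abs_div, abs_two]
    linarith
  · have hpow : ∀ y : ℝ, |y| ≤ 3 → |y| ^ (2 * H) ≤ 9 := by
      intro y hy
      calc |y| ^ (2 * H) ≤ 3 ^ (2 * H) :=
            Real.rpow_le_rpow (abs_nonneg _) hy (by linarith)
        _ ≤ 3 ^ (2 : ℝ) := Real.rpow_le_rpow_of_exponent_le (by norm_num) (by linarith)
        _ = 9 := by norm_num
    have h1 := hpow (x + 1) (abs_le.2 ⟨by linarith, by linarith⟩)
    have h1' := hpow (x - 1) (abs_le.2 ⟨by linarith, by linarith⟩)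
    have h1'' := hpow x (abs_le.2 ⟨by linarith, by linarith⟩)
    have p1 : 0 ≤ |x + 1| ^ (2 * H) := by positivity
    have p2 : 0 ≤ |x - 1| ^ (2 * H) := by positivity
    have p3 : 0 ≤ |x| ^ (2 * H) := by positivity
    have h9 : |fgnCov H x| ≤ 9 := by
      rw [fgnCov]
      exact abs_le.2 ⟨by linarith, by linarith⟩
    have h3 : 1 / 9 ≤ (1 + x) ^ (-(2 - 2 * H)) := by
      calc (1 / 9 : ℝ) = 3 ^ (-2 : ℝ) := by
            rw [Real.rpow_neg (by norm_num)]
            norm_num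
        _ ≤ 3 ^ (-(2 - 2 * H)) := Real.rpow_le_rpow_of_exponent_le (by norm_num) (by linarith)
        _ ≤ _ := Real.rpow_le_rpow_of_nonpos hx1 (by linarith) (by linarith)
    linarith

theorem integral_one_sub_mul_fgnCov {H : ℝ} (hH : 0 < H) :
    ∫ x in (0 : ℝ)..1, (1 - x) * fgnCov H x = (2 ^ (2 * H) - 1) / ((2 * H + 1) * (H + 1)) := by
  set q := 2 * H with hq
  have hq0 : 0 < q := by linarith
  have hcong : ∫ x in (0 : ℝ)..1, (1 - x) * fgnCov H x =
      ∫ x in (0 : ℝ)..1, ((1 - x) * (x + 1) ^ q + (1 - x) ^ (q + 1) - 2 * ((1 - x) * x ^ q)) / 2 := by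
    refine intervalIntegral.integral_congr fun x hx => ?_
    rw [Set.uIcc_of_le zero_le_one] at hx
    rw [fgnCov, ← hq, abs_of_nonneg hx.1, abs_of_nonneg (by linarith [hx.1] : 0 ≤ x + 1),
      abs_sub_comm, abs_of_nonneg (by linarith [hx.2] : 0 ≤ 1 - x),
      Real.rpow_add_one' (by linarith [hx.2]) (by linarith)]
    ring
  have hderiv : ∀ x ∈ Set.uIcc (0 : ℝ) 1, HasDerivAt (fun x : ℝ =>
      ((2 * ((x + 1) ^ (q + 1) / (q + 1)) - (x + 1) ^ (q + 2) / (q + 2)) -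
        (1 - x) ^ (q + 2) / (q + 2) -
        2 * (x ^ (q + 1) / (q + 1) - x ^ (q + 2) / (q + 2))) / 2)
      (((1 - x) * (x + 1) ^ q + (1 - x) ^ (q + 1) - 2 * ((1 - x) * x ^ q)) / 2) x := by
    intro x hx
    rw [Set.uIcc_of_le zero_le_one] at hx
    have hr : ∀ (y r : ℝ), 1 ≤ r → HasDerivAt (fun y : ℝ => y ^ r / r) (y ^ (r - 1)) y := by
      intro y r h1
      have h := (Real.hasDerivAt_rpow_const (x := y) (p := r) (Or.inr h1)).div_const r
      convert! h using 1
      field_simp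
    have a1 := (hr (x + 1) (q + 1) (by linarith)).comp_add_const x 1
    have a2 := (hr (x + 1) (q + 2) (by linarith)).comp_add_const x 1
    have a3 := (hr (1 - x) (q + 2) (by linarith)).comp_const_sub 1 x
    have a4 := hr x (q + 1) (by linarith)
    have a5 := hr x (q + 2) (by linarith)
    have h := ((((a1.const_mul 2).sub a2).sub a3).sub ((a4.sub a5).const_mul 2)).div_const 2
    convert! h using 1
    have e1 : q + 2 - 1 = q + 1 := by ring
    rw [e1, add_sub_cancel_right, Real.rpow_add_one' hx.1 (by linarith),
      Real.rpow_add_one' (by linarith [hx.1] : 0 ≤ x + 1) (by linarith)]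
    ring
  have hcont : Continuous fun x : ℝ =>
      ((1 - x) * (x + 1) ^ q + (1 - x) ^ (q + 1) - 2 * ((1 - x) * x ^ q)) / 2 := by
    have c1 : Continuous fun x : ℝ => (x + 1) ^ q :=
      (continuous_add_const 1).rpow_const fun _ => Or.inr hq0.le
    have c2 : Continuous fun x : ℝ => (1 - x) ^ (q + 1) :=
      (continuous_const.sub continuous_id).rpow_const fun _ => Or.inr (by linarith)
    have c3 : Continuous fun x : ℝ => x ^ q := continuous_id.rpow_const fun _ => Or.inr hq0.le
    fun_prop
  rw [hcong, intervalIntegral.integral_eq_sub_of_hasDerivAt hderiv (hcont.intervalIntegrable _ _)]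
  have z1 : (0 : ℝ) ^ (q + 1) = 0 := Real.zero_rpow (by linarith)
  have z2 : (0 : ℝ) ^ (q + 2) = 0 := Real.zero_rpow (by linarith)
  have t1 : (2 : ℝ) ^ (q + 1) = 2 ^ q * 2 := Real.rpow_add_one (by norm_num) q
  have t2 : (2 : ℝ) ^ (q + 2) = 2 ^ q * 4 := by
    rw [Real.rpow_add (by norm_num)]
    norm_num
  have hHq : H = q / 2 := by linarith
  norm_num [z1, z2, t1, t2]
  rw [hHq]
  field_simp
  ring

namespace IsFBM

variable {P : Measure Ω} {H H₁ H₂ : ℝ} {W W₁ W₂ : ℝ → Ω → ℝ}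

theorem measurable_apply (hW : IsFBM P H W) (t : ℝ) : Measurable (W t) :=
  hW.jointMeasurable.comp measurable_prodMk_left

theorem measurable_path (hW : IsFBM P H W) : Measurable fun ω t => W t ω :=
  measurable_pi_lambda _ hW.measurable_apply

/-- An element of the span of the process is a measurable functional of the path. -/
theorem exists_measurable_comp_path {α : Type*} (W : ℝ → α → ℝ) {X : α → ℝ}
    (hX : X ∈ Submodule.span ℝ (W '' Set.Ici 0)) :
    ∃ F : (ℝ → ℝ) → ℝ, Measurable F ∧ X = fun ω => F fun t => W t ω := by
  induction hX using Submodule.span_induction with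
  | mem X hX =>
    obtain ⟨t, -, rfl⟩ := hX
    exact ⟨fun w => w t, measurable_pi_apply t, rfl⟩
  | zero => exact ⟨fun _ => 0, measurable_const, rfl⟩
  | add X Y _ _ hX hY =>
    obtain ⟨F, hF, rfl⟩ := hX
    obtain ⟨F', hF', rfl⟩ := hY
    exact ⟨fun w => F w + F' w, hF.add hF', rfl⟩
  | smul c X _ hX =>
    obtain ⟨F, hF, rfl⟩ := hX
    exact ⟨fun w => c * F w, hF.const_mul c, rfl⟩

theorem isGaussianSpace_span (hW : IsFBM P H W) :
    IsGaussianSpace P (Submodule.span ℝ (W '' Set.Ici 0)) := by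
  refine ⟨fun X hX => ?_, fun X hX => ?_⟩
  · obtain ⟨F, hF, rfl⟩ := exists_measurable_comp_path W hX
    exact hF.comp hW.measurable_path
  · obtain ⟨n, c, g, rfl⟩ := Submodule.mem_span_set'.1 hX
    choose t ht hgt using fun i => (g i).2
    obtain ⟨v, hv⟩ := hW.gaussian_fdd n t ht c
    refine ⟨v, hv ▸ ?_⟩
    congr 1
    funext ω
    simp [← hgt]

theorem indepFun_of_mem_span
    (hIndep : IndepFun (fun ω t => W₁ t ω) (fun ω t => W₂ t ω) P) {X Y : Ω → ℝ}
    (hX : X ∈ Submodule.span ℝ (W₁ '' Set.Ici 0)) (hY : Y ∈ Submodule.span ℝ (W₂ '' Set.Ici 0)) :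
    IndepFun X Y P := by
  obtain ⟨F, hF, rfl⟩ := exists_measurable_comp_path W₁ hX
  obtain ⟨F', hF', rfl⟩ := exists_measurable_comp_path W₂ hY
  exact hIndep.comp hF hF'

theorem isGaussianSpace_sup (hW₁ : IsFBM P H₁ W₁) (hW₂ : IsFBM P H₂ W₂)
    (hIndep : IndepFun (fun ω t => W₁ t ω) (fun ω t => W₂ t ω) P) :
    IsGaussianSpace P
      (Submodule.span ℝ (W₁ '' Set.Ici 0) ⊔ Submodule.span ℝ (W₂ '' Set.Ici 0)) := by
  have h₁ := hW₁.isGaussianSpace_span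
  have h₂ := hW₂.isGaussianSpace_span
  refine ⟨fun Z hZ => ?_, fun Z hZ => ?_⟩ <;>
    obtain ⟨X, hX, Y, hY, rfl⟩ := Submodule.mem_sup.1 hZ
  · exact (h₁.measurable X hX).add (h₂.measurable Y hY)
  · obtain ⟨v, hv⟩ := h₁.gaussian X hX
    obtain ⟨v', hv'⟩ := h₂.gaussian Y hY
    refine ⟨v + v', ?_⟩
    rw [gaussianReal_add_gaussianReal_of_indepFun (indepFun_of_mem_span hIndep hX hY) hv hv',
      add_zero]

theorem integral_mul_eq_zero (hW₁ : IsFBM P H₁ W₁) (hW₂ : IsFBM P H₂ W₂)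
    (hIndep : IndepFun (fun ω t => W₁ t ω) (fun ω t => W₂ t ω) P) {X Y : Ω → ℝ}
    (hX : X ∈ Submodule.span ℝ (W₁ '' Set.Ici 0)) (hY : Y ∈ Submodule.span ℝ (W₂ '' Set.Ici 0)) :
    ∫ ω, X ω * Y ω ∂P = 0 := by
  have hXm := hW₁.isGaussianSpace_span.measurable X hX
  have hYm := hW₂.isGaussianSpace_span.measurable Y hY
  rw [(indepFun_of_mem_span hIndep hX hY).integral_fun_mul_eq_mul_integral
    hXm.aestronglyMeasurable hYm.aestronglyMeasurable,
    hW₁.isGaussianSpace_span.integral_eq_zero hX, zero_mul]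

end IsFBM

/-- Increments of `W` over windows of length `δ`, on the time scale `δ`. -/
def scaledIncrement {α : Type*} (W : ℝ → α → ℝ) (δ s : ℝ) : α → ℝ :=
  fun ω => W (δ * (s + 1)) ω - W (δ * s) ω

namespace IsFBM

variable {P : Measure Ω} {H H₁ H₂ : ℝ} {W W₁ W₂ : ℝ → Ω → ℝ}

theorem scaledIncrement_mem_span {α : Type*} (W : ℝ → α → ℝ) {δ s : ℝ} (hδ : 0 < δ) (hs : 0 ≤ s) :
    scaledIncrement W δ s ∈ Submodule.span ℝ (W '' Set.Ici 0) :=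
  Submodule.sub_mem _
    (Submodule.subset_span ⟨_, Set.mem_Ici.2 (by positivity), rfl⟩)
    (Submodule.subset_span ⟨_, Set.mem_Ici.2 (by positivity), rfl⟩)

theorem integral_scaledIncrement_mul (hW : IsFBM P H W) {δ s t : ℝ} (hδ : 0 < δ) (hs : 0 ≤ s)
    (ht : 0 ≤ t) :
    ∫ ω, scaledIncrement W δ s ω * scaledIncrement W δ t ω ∂P =
      δ ^ (2 * H) * fgnCov H |s - t| := by
  have hG := hW.isGaussianSpace_span
  have hmem : ∀ u, 0 ≤ u → W u ∈ Submodule.span ℝ (W '' Set.Ici 0) := fun u hu =>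
    Submodule.subset_span ⟨u, hu, rfl⟩
  have i : ∀ u v, 0 ≤ u → 0 ≤ v → Integrable (fun ω => W u ω * W v ω) P := fun u v hu hv =>
    hG.integrable_mul (hmem u hu) (hmem v hv)
  have hs0 : 0 ≤ δ * s := by positivity
  have hs1 : 0 ≤ δ * (s + 1) := by positivity
  have ht0 : 0 ≤ δ * t := by positivity
  have ht1 : 0 ≤ δ * (t + 1) := by positivity
  have hexp : ∫ ω, scaledIncrement W δ s ω * scaledIncrement W δ t ω ∂P =
      ∫ ω, ((W (δ * (s + 1)) ω * W (δ * (t + 1)) ω - W (δ * (s + 1)) ω * W (δ * t) ω) -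
        (W (δ * s) ω * W (δ * (t + 1)) ω - W (δ * s) ω * W (δ * t) ω)) ∂P := by
    congr 1 with ω
    simp only [scaledIncrement]
    ring
  have i1 : Integrable (fun ω => W (δ * (s + 1)) ω * W (δ * (t + 1)) ω -
      W (δ * (s + 1)) ω * W (δ * t) ω) P := (i _ _ hs1 ht1).sub (i _ _ hs1 ht0)
  have i2 : Integrable (fun ω => W (δ * s) ω * W (δ * (t + 1)) ω -
      W (δ * s) ω * W (δ * t) ω) P := (i _ _ hs0 ht1).sub (i _ _ hs0 ht0)
  have habs : ∀ u v x : ℝ, u - v = δ * x → |u - v| ^ (2 * H) = δ ^ (2 * H) * |x| ^ (2 * H) := by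
    intro u v x h
    rw [h, abs_mul, abs_of_pos hδ, Real.mul_rpow hδ.le (abs_nonneg _)]
  rw [hexp, integral_sub i1 i2, integral_sub (i _ _ hs1 ht1) (i _ _ hs1 ht0),
    integral_sub (i _ _ hs0 ht1) (i _ _ hs0 ht0), hW.cov _ _ hs1 ht1, hW.cov _ _ hs1 ht0,
    hW.cov _ _ hs0 ht1, hW.cov _ _ hs0 ht0, habs (δ * (s + 1)) (δ * (t + 1)) (s - t) (by ring),
    habs (δ * (s + 1)) (δ * t) (s - t + 1) (by ring),
    habs (δ * s) (δ * (t + 1)) (s - t - 1) (by ring), habs (δ * s) (δ * t) (s - t) (by ring),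
    fgnCov_abs, fgnCov]
  ring

theorem integral_mixed_scaledIncrement_mul (hW₁ : IsFBM P H₁ W₁) (hW₂ : IsFBM P H₂ W₂)
    (hIndep : IndepFun (fun ω t => W₁ t ω) (fun ω t => W₂ t ω) P) (a b : ℝ) {δ s t : ℝ}
    (hδ : 0 < δ) (hs : 0 ≤ s) (ht : 0 ≤ t) :
    ∫ ω, (a • scaledIncrement W₁ δ s + b • scaledIncrement W₂ δ s) ω *
        (a • scaledIncrement W₁ δ t + b • scaledIncrement W₂ δ t) ω ∂P =
      a ^ 2 * δ ^ (2 * H₁) * fgnCov H₁ |s - t| + b ^ 2 * δ ^ (2 * H₂) * fgnCov H₂ |s - t| := by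
  have m₁ := fun u (hu : 0 ≤ u) => scaledIncrement_mem_span W₁ hδ hu
  have m₂ := fun u (hu : 0 ≤ u) => scaledIncrement_mem_span W₂ hδ hu
  have hG := hW₁.isGaussianSpace_sup hW₂ hIndep
  have n₁ := fun u (hu : 0 ≤ u) => Submodule.mem_sup_left
    (T := Submodule.span ℝ (W₂ '' Set.Ici 0)) (m₁ u hu)
  have n₂ := fun u (hu : 0 ≤ u) => Submodule.mem_sup_right
    (S := Submodule.span ℝ (W₁ '' Set.Ici 0)) (m₂ u hu)
  have i11 := (hG.integrable_mul (n₁ s hs) (n₁ t ht)).const_mul (a ^ 2)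
  have i12 := (hG.integrable_mul (n₁ s hs) (n₂ t ht)).const_mul (a * b)
  have i21 := (hG.integrable_mul (n₁ t ht) (n₂ s hs)).const_mul (a * b)
  have i22 := (hG.integrable_mul (n₂ s hs) (n₂ t ht)).const_mul (b ^ 2)
  have hexp : ∀ ω, (a • scaledIncrement W₁ δ s + b • scaledIncrement W₂ δ s) ω *
        (a • scaledIncrement W₁ δ t + b • scaledIncrement W₂ δ t) ω =
      (a ^ 2 * (scaledIncrement W₁ δ s ω * scaledIncrement W₁ δ t ω) +
        a * b * (scaledIncrement W₁ δ s ω * scaledIncrement W₂ δ t ω)) +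
      (a * b * (scaledIncrement W₁ δ t ω * scaledIncrement W₂ δ s ω) +
        b ^ 2 * (scaledIncrement W₂ δ s ω * scaledIncrement W₂ δ t ω)) := by
    intro ω
    simp only [Pi.add_apply, Pi.smul_apply, smul_eq_mul]
    ring
  simp_rw [hexp]
  have i1 : Integrable (fun ω =>
      a ^ 2 * (scaledIncrement W₁ δ s ω * scaledIncrement W₁ δ t ω) +
        a * b * (scaledIncrement W₁ δ s ω * scaledIncrement W₂ δ t ω)) P := i11.add i12
  have i2 : Integrable (fun ω =>
      a * b * (scaledIncrement W₁ δ t ω * scaledIncrement W₂ δ s ω) +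
        b ^ 2 * (scaledIncrement W₂ δ s ω * scaledIncrement W₂ δ t ω)) P := i21.add i22
  rw [integral_add i1 i2, integral_add i11 i12, integral_add i21 i22]
  simp_rw [integral_const_mul]
  rw [hW₁.integral_scaledIncrement_mul hδ hs ht, hW₂.integral_scaledIncrement_mul hδ hs ht,
    hW₁.integral_mul_eq_zero hW₂ hIndep (m₁ s hs) (m₂ t ht),
    hW₁.integral_mul_eq_zero hW₂ hIndep (m₁ t ht) (m₂ s hs)]
  ring

end IsFBM

theorem nifBm_increment_eq {α : Type*} {W : ℝ → α → ℝ} {ω : α} (hW : Continuous fun t => W t ω) {δ : ℝ}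
    (hδ : δ ≠ 0) (k : ℕ) :
    nifBm W δ (((k + 1 : ℕ) : ℝ) * δ) ω - nifBm W δ ((k : ℝ) * δ) ω =
      ∫ x in (0 : ℝ)..1, scaledIncrement W δ (k + x) ω := by
  have h : ∀ j : ℝ, nifBm W δ (j * δ) ω = ∫ x in (0 : ℝ)..1, W (δ * (j + x)) ω := by
    intro j
    have h1 : ∀ x : ℝ, W (δ * (j + x)) ω = (fun u => W u ω) (δ * j + δ * x) := by
      intro x
      simp only
      ring_nf
    simp_rw [h1]
    rw [intervalIntegral.integral_comp_add_mul (fun u => W u ω) hδ, nifBm, smul_eq_mul, one_div]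
    ring_nf
  have hc : ∀ j : ℝ, IntervalIntegrable (fun x => W (δ * (j + x)) ω) volume 0 1 := fun j =>
    Continuous.intervalIntegrable (hW.comp (by fun_prop : Continuous fun x => δ * (j + x))) _ _
  rw [h, h, ← intervalIntegral.integral_sub (hc _) (hc _)]
  refine intervalIntegral.integral_congr fun x _ => ?_
  simp only [scaledIncrement]
  push_cast
  ring_nf

/-- Almost sure limit of the quadratic variation statistics. -/
theorem ae_tendsto_xiTwo {P : Measure Ω} [IsProbabilityMeasure P] {H₁ H₂ : ℝ}
    (hH₂pos : 0 < H₂) (hH : H₂ < H₁) (hH₁lt : H₁ < 1) {W₁ W₂ : ℝ → Ω → ℝ}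
    (hW₁ : IsFBM P H₁ W₁) (hW₂ : IsFBM P H₂ W₂)
    (hIndep : IndepFun (fun ω t => W₁ t ω) (fun ω t => W₂ t ω) P)
    (a b : ℝ) {h : ℝ} (hh : 0 < h) {j : ℕ} (hj : 0 < j) :
    ∀ᵐ ω ∂P, Tendsto (fun N : ℕ => xiTwo W₁ W₂ a b h j N ω) atTop
      (𝓝 (a ^ 2 * ((j : ℝ) * h) ^ (2 * H₁) *
          (2 * (2 ^ (2 * H₁) - 1) / ((2 * H₁ + 1) * (H₁ + 1))) +
        b ^ 2 * ((j : ℝ) * h) ^ (2 * H₂) *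
          (2 * (2 ^ (2 * H₂) - 1) / ((2 * H₂ + 1) * (H₂ + 1))))) := by
  have hj0 : (0 : ℝ) < j := by exact_mod_cast hj
  set δ : ℝ := (j : ℝ) * h with hδdef
  have hδ : 0 < δ := by positivity
  set A := a ^ 2 * δ ^ (2 * H₁) with hA
  set B := b ^ 2 * δ ^ (2 * H₂) with hB
  have hA0 : 0 ≤ A := by positivity
  have hB0 : 0 ≤ B := by positivity
  set U : ℝ → Ω → ℝ := fun s => a • scaledIncrement W₁ δ s + b • scaledIncrement W₂ δ s with hU
  set R : ℝ → ℝ := fun x => A * fgnCov H₁ x + B * fgnCov H₂ x with hR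
  have hH₁pos : 0 < H₁ := hH₂pos.trans hH
  have c₁ := continuous_fgnCov hH₁pos
  have c₂ := continuous_fgnCov hH₂pos
  have hRc : Continuous R := by fun_prop
  set β := min (2 - 2 * H₁) (1 / 4) with hβ
  have hβ0 : 0 < β := lt_min (by linarith) (by norm_num)
  have hβ1 : 2 * β < 1 := by linarith [min_le_right (2 - 2 * H₁) (1 / 4)]
  have hβH : β ≤ 2 - 2 * H₁ := min_le_left _ _
  have hdec : ∀ H, 0 < H → H ≤ H₁ → ∀ x, 0 ≤ x → |fgnCov H x| ≤ 81 * (1 + x) ^ (-β) := by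
    intro H h0 h1 x hx
    refine (abs_fgnCov_le h0 (by linarith) hx).trans ?_
    gcongr
    · linarith
    · linarith
  have hdecay : ∀ x, 0 ≤ x → |R x| ≤ (A + B) * 81 * (1 + x) ^ (-β) := by
    intro x hx
    have h1 := mul_le_mul_of_nonneg_left (hdec H₁ hH₁pos le_rfl x hx) hA0
    have h2 := mul_le_mul_of_nonneg_left (hdec H₂ hH₂pos hH.le x hx) hB0
    have h3 := abs_add_le (A * fgnCov H₁ x) (B * fgnCov H₂ x)
    rw [abs_mul A, abs_mul B, abs_of_nonneg hA0, abs_of_nonneg hB0] at h3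
    linarith
  have hcont : ∀ᵐ ω ∂P, Continuous fun t => U t ω := by
    filter_upwards [hW₁.cont, hW₂.cont] with ω h₁ h₂
    have hc : ∀ W : ℝ → Ω → ℝ, Continuous (fun t => W t ω) →
        Continuous fun s => scaledIncrement W δ s ω := fun W hW =>
      (hW.comp (by fun_prop : Continuous fun s : ℝ => δ * (s + 1))).sub
        (hW.comp (by fun_prop : Continuous fun s : ℝ => δ * s))
    exact ((hc W₁ h₁).const_mul a).add ((hc W₂ h₂).const_mul b)
  have hlim := ae_tendsto_empirical_sq_integral (hW₁.isGaussianSpace_sup hW₂ hIndep) (U := U)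
    (R := R) (fun s hs => Submodule.add_mem _
      (Submodule.smul_mem _ a (Submodule.mem_sup_left (IsFBM.scaledIncrement_mem_span W₁ hδ hs)))
      (Submodule.smul_mem _ b (Submodule.mem_sup_right (IsFBM.scaledIncrement_mem_span W₂ hδ hs))))
    (fun s t hs ht => hW₁.integral_mixed_scaledIncrement_mul hW₂ hIndep a b hδ hs ht)
    hcont hRc (by positivity) hβ0 hβ1 hdecay
  have hval : 2 * ∫ x in (0 : ℝ)..1, (1 - x) * R x =
      A * (2 * (2 ^ (2 * H₁) - 1) / ((2 * H₁ + 1) * (H₁ + 1))) +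
        B * (2 * (2 ^ (2 * H₂) - 1) / ((2 * H₂ + 1) * (H₂ + 1))) := by
    have e : ∀ x, (1 - x) * R x = A * ((1 - x) * fgnCov H₁ x) + B * ((1 - x) * fgnCov H₂ x) := by
      intro x
      simp only [hR]
      ring
    simp_rw [e]
    rw [intervalIntegral.integral_add (Continuous.intervalIntegrable (by fun_prop) _ _)
      (Continuous.intervalIntegrable (by fun_prop) _ _), intervalIntegral.integral_const_mul,
      intervalIntegral.integral_const_mul, integral_one_sub_mul_fgnCov hH₁pos,
      integral_one_sub_mul_fgnCov hH₂pos]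
    ring
  rw [hval] at hlim
  filter_upwards [hlim, hW₁.cont, hW₂.cont] with ω hω h₁ h₂
  refine hω.congr fun N => ?_
  rw [xiTwo]
  congr 1
  refine Finset.sum_congr rfl fun k _ => ?_
  congr 1
  have i : ∀ W : ℝ → Ω → ℝ, Continuous (fun t => W t ω) →
      IntervalIntegrable (fun x => scaledIncrement W δ (k + x) ω) volume 0 1 := fun W hW =>
    Continuous.intervalIntegrable
      ((hW.comp (by fun_prop : Continuous fun x : ℝ => δ * (k + x + 1))).sub
        (hW.comp (by fun_prop : Continuous fun x : ℝ => δ * (k + x)))) _ _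
  calc ∫ x in (0 : ℝ)..1, U (k + x) ω
      = a * (∫ x in (0 : ℝ)..1, scaledIncrement W₁ δ (k + x) ω) +
        b * ∫ x in (0 : ℝ)..1, scaledIncrement W₂ δ (k + x) ω := by
        rw [← intervalIntegral.integral_const_mul, ← intervalIntegral.integral_const_mul,
          ← intervalIntegral.integral_add ((i W₁ h₁).const_mul a) ((i W₂ h₂).const_mul b)]
        rfl
    _ = _ := by
        rw [← nifBm_increment_eq h₁ hδ.ne', ← nifBm_increment_eq h₂ hδ.ne', tXj, tXj]
        ring

section Estimators

variable {ι : Type*} {l : Filter ι} {ξ₁ ξ₂ ξ₄ ξ₈ : ι → ℝ} {A B x y : ℝ}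

theorem tendsto_of_tendsto_of_eq {f : ι → ℝ} {c d : ℝ} (hf : Tendsto f l (𝓝 c)) (h : c = d) :
    Tendsto f l (𝓝 d) :=
  h ▸ hf

theorem tendsto_logpos {f : ι → ℝ} (hx : 0 < x) (hf : Tendsto f l (𝓝 x)) :
    Tendsto (fun n => logpos (f n)) l (𝓝 (Real.log x)) := by
  refine (hf.log hx.ne').congr' ?_
  filter_upwards [hf.eventually_const_lt hx] with n hn
  rw [logpos, if_pos hn]

theorem tendsto_xStat_yStat (hA : 0 < A) (hB : 0 < B) (hxy : y < x)
    (h₁ : Tendsto ξ₁ l (𝓝 (A + B))) (h₂ : Tendsto ξ₂ l (𝓝 (A * x + B * y)))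
    (h₄ : Tendsto ξ₄ l (𝓝 (A * x ^ 2 + B * y ^ 2)))
    (h₈ : Tendsto ξ₈ l (𝓝 (A * x ^ 3 + B * y ^ 3))) :
    Tendsto (fun n => xStat (ξ₁ n) (ξ₂ n) (ξ₄ n) (ξ₈ n)) l (𝓝 x) ∧
      Tendsto (fun n => yStat (ξ₁ n) (ξ₂ n) (ξ₄ n) (ξ₈ n)) l (𝓝 y) := by
  have hxy' : 0 < x - y := sub_pos.2 hxy
  have hD : Tendsto (fun n => √(DStat (ξ₁ n) (ξ₂ n) (ξ₄ n) (ξ₈ n))) l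
      (𝓝 (A * B * (x - y) ^ 3)) := by
    have h := (((h₄.mul h₂).sub (h₈.mul h₁)).pow 2).sub
      ((((h₄.mul h₁).sub (h₂.pow 2)).const_mul 4).mul ((h₈.mul h₂).sub (h₄.pow 2)))
    refine tendsto_of_tendsto_of_eq h.sqrt ?_
    rw [← Real.sqrt_sq (by positivity : 0 ≤ A * B * (x - y) ^ 3)]
    congr 1
    ring
  have hnum := (h₈.mul h₁).sub (h₄.mul h₂)
  have hden := ((h₄.mul h₁).sub (h₂.pow 2)).const_mul 2
  have e : 2 * ((A * x ^ 2 + B * y ^ 2) * (A + B) - (A * x + B * y) ^ 2) =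
      2 * (A * B * (x - y) ^ 2) := by ring
  have hne : 2 * (A * B * (x - y) ^ 2) ≠ 0 := by positivity
  rw [e] at hden
  constructor
  · refine tendsto_of_tendsto_of_eq ((hnum.add hD).div hden hne) ?_
    rw [div_eq_iff hne]
    ring
  · refine tendsto_of_tendsto_of_eq ((hnum.sub hD).div hden hne) ?_
    rw [div_eq_iff hne]
    ring

/-- If the four statistics converge to the moments `A xⁱ + B yⁱ` prescribed by the parameters,
then the estimators converge to the parameters. -/
theorem tendsto_estimators {H₁ H₂ a b h : ℝ} (hH₂ : 0 < H₂) (hH : H₂ < H₁) (ha : a ≠ 0)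
    (hb : b ≠ 0) (hh : 0 < h) (hx : x = 2 ^ (2 * H₁)) (hy : y = 2 ^ (2 * H₂))
    (hA : A = a ^ 2 * h ^ (2 * H₁) * (2 * (x - 1) / ((2 * H₁ + 1) * (H₁ + 1))))
    (hB : B = b ^ 2 * h ^ (2 * H₂) * (2 * (y - 1) / ((2 * H₂ + 1) * (H₂ + 1))))
    (h₁ : Tendsto ξ₁ l (𝓝 (A + B))) (h₂ : Tendsto ξ₂ l (𝓝 (A * x + B * y)))
    (h₄ : Tendsto ξ₄ l (𝓝 (A * x ^ 2 + B * y ^ 2)))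
    (h₈ : Tendsto ξ₈ l (𝓝 (A * x ^ 3 + B * y ^ 3))) :
    Tendsto (fun n => H1Stat (ξ₁ n) (ξ₂ n) (ξ₄ n) (ξ₈ n)) l (𝓝 H₁) ∧
      Tendsto (fun n => H2Stat (ξ₁ n) (ξ₂ n) (ξ₄ n) (ξ₈ n)) l (𝓝 H₂) ∧
      Tendsto (fun n => a2Stat h (ξ₁ n) (ξ₂ n) (ξ₄ n) (ξ₈ n)) l (𝓝 (a ^ 2)) ∧
      Tendsto (fun n => b2Stat h (ξ₁ n) (ξ₂ n) (ξ₄ n) (ξ₈ n)) l (𝓝 (b ^ 2)) := by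
  have hH₁ : 0 < H₁ := hH₂.trans hH
  have hy1 : 1 < y := hy ▸ Real.one_lt_rpow (by norm_num) (by positivity)
  have hxy : y < x := hx ▸ hy ▸ Real.rpow_lt_rpow_of_exponent_lt (by norm_num) (by linarith)
  have hy1' : 0 < y - 1 := by linarith
  have hx1' : 0 < x - 1 := by linarith
  have hxy' : 0 < x - y := by linarith
  have hA0 : 0 < A := by
    rw [hA]
    positivity
  have hB0 : 0 < B := by
    rw [hB]
    positivity
  obtain ⟨tx, ty⟩ := tendsto_xStat_yStat hA0 hB0 hxy h₁ h₂ h₄ h₈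
  have hlog2 : Real.log 2 ≠ 0 := (Real.log_pos (by norm_num)).ne'
  have hH1 : Tendsto (fun n => H1Stat (ξ₁ n) (ξ₂ n) (ξ₄ n) (ξ₈ n)) l (𝓝 H₁) := by
    refine tendsto_of_tendsto_of_eq ((tendsto_logpos (by linarith) tx).const_mul _) ?_
    rw [hx, Real.log_rpow (by norm_num)]
    field_simp
  have hH2 : Tendsto (fun n => H2Stat (ξ₁ n) (ξ₂ n) (ξ₄ n) (ξ₈ n)) l (𝓝 H₂) := by
    refine tendsto_of_tendsto_of_eq ((tendsto_logpos (by linarith) ty).const_mul _) ?_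
    rw [hy, Real.log_rpow (by norm_num)]
    field_simp
  have hcoef : ∀ {K : ι → ℝ} {H : ℝ}, Tendsto K l (𝓝 H) →
      Tendsto (fun n => (2 * K n + 1) * (K n + 1)) l (𝓝 ((2 * H + 1) * (H + 1))) ∧
        Tendsto (fun n => 2 * h ^ (2 * K n)) l (𝓝 (2 * h ^ (2 * H))) := fun hK =>
    ⟨((hK.const_mul 2).add_const 1).mul (hK.add_const 1),
      (tendsto_const_nhds.rpow (hK.const_mul 2) (Or.inl hh.ne')).const_mul 2⟩
  have hp₁ : 0 < h ^ (2 * H₁) := by positivity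
  have hp₂ : 0 < h ^ (2 * H₂) := by positivity
  refine ⟨hH1, hH2, ?_, ?_⟩
  · have hne : 2 * h ^ (2 * H₁) * (x - y) * (x - 1) ≠ 0 := by positivity
    refine tendsto_of_tendsto_of_eq (((hcoef hH1).1.mul (h₂.sub (ty.mul h₁))).div
      (((hcoef hH1).2.mul (tx.sub ty)).mul (tx.sub_const 1)) hne) ?_
    rw [div_eq_iff hne, hA]
    field_simp
    ring
  · have hne : 2 * h ^ (2 * H₂) * (y - x) * (y - 1) ≠ 0 :=
      mul_ne_zero (mul_ne_zero (by positivity) (by linarith)) hy1'.ne'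
    refine tendsto_of_tendsto_of_eq (((hcoef hH2).1.mul (h₂.sub (tx.mul h₁))).div
      (((hcoef hH2).2.mul (ty.sub tx)).mul (ty.sub_const 1)) hne) ?_
    rw [div_eq_iff hne, hB]
    field_simp
    ring

end Estimators

/-- Strong consistency of `θ̂_N = (Ĥ_{1,N}, Ĥ_{2,N}, â²_N, b̂²_N)`:
if `0 < H₂ < H₁ < 1` and `a, b ≠ 0`, then `θ̂_N → (H₁, H₂, a², b²)` almost surely. -/
theorem full_estimator_two_nifBm_strongly_consistent
    (P : Measure Ω) [IsProbabilityMeasure P]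
    (H₁ H₂ : ℝ) (hH₂pos : 0 < H₂) (hH : H₂ < H₁) (hH₁lt : H₁ < 1)
    (W₁ W₂ : ℝ → Ω → ℝ) (hW₁ : IsFBM P H₁ W₁) (hW₂ : IsFBM P H₂ W₂)
    (hIndep : IndepFun (fun ω t => W₁ t ω) (fun ω t => W₂ t ω) P)
    (a b : ℝ) (ha : a ≠ 0) (hb : b ≠ 0) (h : ℝ) (hh : 0 < h) :
    ∀ᵐ ω ∂P,
      Tendsto (fun N : ℕ => H1Stat (xiTwo W₁ W₂ a b h 1 N ω) (xiTwo W₁ W₂ a b h 2 N ω)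
          (xiTwo W₁ W₂ a b h 4 N ω) (xiTwo W₁ W₂ a b h 8 N ω)) atTop (𝓝 H₁) ∧
      Tendsto (fun N : ℕ => H2Stat (xiTwo W₁ W₂ a b h 1 N ω) (xiTwo W₁ W₂ a b h 2 N ω)
          (xiTwo W₁ W₂ a b h 4 N ω) (xiTwo W₁ W₂ a b h 8 N ω)) atTop (𝓝 H₂) ∧
      Tendsto (fun N : ℕ => a2Stat h (xiTwo W₁ W₂ a b h 1 N ω) (xiTwo W₁ W₂ a b h 2 N ω)
          (xiTwo W₁ W₂ a b h 4 N ω) (xiTwo W₁ W₂ a b h 8 N ω)) atTop (𝓝 (a^2)) ∧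
      Tendsto (fun N : ℕ => b2Stat h (xiTwo W₁ W₂ a b h 1 N ω) (xiTwo W₁ W₂ a b h 2 N ω)
          (xiTwo W₁ W₂ a b h 4 N ω) (xiTwo W₁ W₂ a b h 8 N ω)) atTop (𝓝 (b^2)) := by
  have key := fun (j : ℕ) (hj : 0 < j) =>
    ae_tendsto_xiTwo hH₂pos hH hH₁lt hW₁ hW₂ hIndep a b hh hj
  have hp : ∀ (H : ℝ) (j : ℕ), (((2 ^ j : ℕ) : ℝ) * h) ^ (2 * H) =
      ((2 : ℝ) ^ (2 * H)) ^ j * h ^ (2 * H) := by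
    intro H j
    rw [Real.mul_rpow (by positivity) hh.le]
    push_cast
    rw [← Real.rpow_natCast, ← Real.rpow_natCast, ← Real.rpow_mul (by norm_num),
      ← Real.rpow_mul (by norm_num), mul_comm (j : ℝ)]
  filter_upwards [key (2 ^ 0) (by norm_num), key (2 ^ 1) (by norm_num), key (2 ^ 2) (by norm_num),
    key (2 ^ 3) (by norm_num)] with ω h₁ h₂ h₄ h₈
  obtain ⟨x, hx⟩ : ∃ x : ℝ, x = 2 ^ (2 * H₁) := ⟨_, rfl⟩
  obtain ⟨y, hy⟩ : ∃ y : ℝ, y = 2 ^ (2 * H₂) := ⟨_, rfl⟩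
  simp only [hp, ← hx, ← hy] at h₁ h₂ h₄ h₈
  refine tendsto_estimators hH₂pos hH ha hb hh hx hy rfl rfl (tendsto_of_tendsto_of_eq h₁ ?_)
    (tendsto_of_tendsto_of_eq h₂ ?_) (tendsto_of_tendsto_of_eq h₄ ?_)
    (tendsto_of_tendsto_of_eq h₈ ?_) <;>
  · generalize h ^ (2 * H₁) = p, h ^ (2 * H₂) = q
    ring
end
end

section
/- Let 0 < H < 3/4. Then for all integers α, β, the series ∑_{i ∈ ℤ} |γ(H, i+α) · γ(H, i+β)| converges (is finite). In particular ∑_{i ∈ ℤ} γ(H, i)² < ∞, and ∑_{i ∈ ℤ} |γ(H, i+α) γ(H, i+β)| ≤ ∑_{i ∈ ℤ} γ(H, i)². -/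
open MeasureTheory ProbabilityTheory Filter Real Matrix Topology

noncomputable section

variable {Ω : Type*} [MeasurableSpace Ω]

/-- An iterated forward difference is bounded by any bound on the derivative of the same order. -/
lemma abs_fwdDiff_iter_le {a M : ℝ} (k : ℕ) (f : ℕ → ℝ → ℝ)
    (hf : ∀ j, ∀ y, a ≤ y → HasDerivAt (f j) (f (j + 1) y) y)
    (hM : ∀ y, a ≤ y → |f k y| ≤ M) (x : ℝ) (hx : a ≤ x) :
    |(fwdDiff (1 : ℝ))^[k] (f 0) x| ≤ M := by
  induction k generalizing f with
  | zero => exact hM x hx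
  | succ k ih =>
    rw [Function.iterate_succ_apply]
    refine ih (fun j => fwdDiff 1 (f j)) (fun j y hy => ?_) (fun y hy => ?_)
    · exact ((hf j (y + 1) (by linarith)).comp_add_const y 1).sub (hf j y hy)
    · obtain ⟨c, hc, hc'⟩ := exists_hasDerivAt_eq_slope (f k) (f (k + 1)) (lt_add_one y)
        (fun z hz => (hf k z (hy.trans hz.1)).continuousAt.continuousWithinAt)
        (fun z hz => hf k z (hy.trans hz.1.le))
      have h : fwdDiff 1 (f k) y = f (k + 1) c := by
        rw [hc', fwdDiff]; simp
      rw [h]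
      exact hM c (hy.trans hc.1.le)

lemma gam_neg (H : ℝ) (n : ℤ) : gam H (-n) = gam H n := by
  unfold gam
  have h1 : |((-n : ℤ) : ℝ) - 2| = |(n : ℝ) + 2| := by
    rw [← abs_neg]; congr 1; push_cast; ring
  have h2 : |((-n : ℤ) : ℝ) - 1| = |(n : ℝ) + 1| := by
    rw [← abs_neg]; congr 1; push_cast; ring
  have h3 : |((-n : ℤ) : ℝ) + 2| = |(n : ℝ) - 2| := by
    rw [← abs_neg]; congr 1; push_cast; ring
  have h4 : |((-n : ℤ) : ℝ) + 1| = |(n : ℝ) - 1| := by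
    rw [← abs_neg]; congr 1; push_cast; ring
  have h5 : |((-n : ℤ) : ℝ)| = |(n : ℝ)| := by
    rw [← abs_neg]; congr 1; push_cast; ring
  rw [h1, h2, h3, h4, h5]
  ring

/-- The fourth difference of `x ↦ x ^ p` decays like `x ^ (p - 4)`. -/
lemma abs_fourth_difference_rpow_le {p a : ℝ} (hp : p ≤ 4) (ha : 0 < a) :
    |a ^ p - 4 * (a + 1) ^ p + 6 * (a + 2) ^ p - 4 * (a + 3) ^ p + (a + 4) ^ p|
      ≤ |p * (p - 1) * (p - 2) * (p - 3)| * a ^ (p - 4) := by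
  have h := abs_fwdDiff_iter_le (a := a)
    (M := |p * (p - 1) * (p - 2) * (p - 3)| * a ^ (p - 4)) 4
    (fun j y => (∏ i ∈ Finset.range j, (p - i)) * y ^ (p - j))
    (fun j y hy => ?_) (fun y hy => ?_) a le_rfl
  · convert h using 2
    simp only [Function.iterate_succ, Function.iterate_zero, Function.comp_apply, id_eq, fwdDiff,
      Finset.range_zero, Finset.prod_empty, Nat.cast_zero, sub_zero, one_mul]
    rw [show a + 1 + 1 = a + 2 by ring, show a + 2 + 1 = a + 3 by ring,
      show a + 3 + 1 = a + 4 by ring]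
    ring
  · refine ((Real.hasDerivAt_rpow_const (p := p - j) (Or.inl (ha.trans_le hy).ne')).const_mul
      (∏ i ∈ Finset.range j, (p - i))).congr_deriv ?_
    rw [Finset.prod_range_succ]
    push_cast
    rw [show p - (j + 1 : ℝ) = p - j - 1 by ring]
    ring
  · have hy0 : 0 < y := ha.trans_le hy
    rw [abs_mul, abs_of_pos (Real.rpow_pos_of_pos hy0 _)]
    have : ∏ i ∈ Finset.range 4, (p - (i : ℝ)) = p * (p - 1) * (p - 2) * (p - 3) := by
      simp [Finset.prod_range_succ]
    rw [this]
    exact mul_le_mul_of_nonneg_left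
      (Real.rpow_le_rpow_of_nonpos ha hy (by push_cast; linarith)) (abs_nonneg _)

lemma exists_abs_gam_le {H : ℝ} (hH : H ≤ 1) :
    ∃ C : ℝ, ∀ n : ℕ, |gam H ((n + 3 : ℕ) : ℤ)| ≤ C * ((n + 1 : ℕ) : ℝ) ^ (2 * H - 2) := by
  refine ⟨|(2 * H + 2) * (2 * H + 2 - 1) * (2 * H + 2 - 2) * (2 * H + 2 - 3)| /
    |4 * (2 * H + 1) * (H + 1)|, fun n => ?_⟩
  have ha : (0 : ℝ) < (n : ℝ) + 1 := by positivity
  have h := abs_fourth_difference_rpow_le (p := 2 * H + 2) (by linarith) ha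
  unfold gam
  rw [abs_div, div_mul_eq_mul_div]
  refine div_le_div_of_nonneg_right ?_ (abs_nonneg _)
  push_cast
  rw [show (n : ℝ) + 3 - 2 = n + 1 by ring, show (n : ℝ) + 3 - 1 = n + 1 + 1 by ring,
    show (n : ℝ) + 3 + 1 = n + 1 + 3 by ring, show (n : ℝ) + 3 + 2 = n + 1 + 4 by ring,
    show (n : ℝ) + 3 = n + 1 + 2 by ring,
    abs_of_pos ha, abs_of_pos (by positivity : (0 : ℝ) < (n : ℝ) + 1 + 1),
    abs_of_pos (by positivity : (0 : ℝ) < (n : ℝ) + 1 + 2),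
    abs_of_pos (by positivity : (0 : ℝ) < (n : ℝ) + 1 + 3),
    abs_of_pos (by positivity : (0 : ℝ) < (n : ℝ) + 1 + 4)]
  rwa [show 2 * H + 2 - 4 = 2 * H - 2 by ring] at h

lemma summable_gam_sq {H : ℝ} (hH : H < 3 / 4) : Summable fun i : ℤ => gam H i ^ 2 := by
  obtain ⟨C, hC⟩ := exists_abs_gam_le (H := H) (by linarith)
  have hnat : Summable fun n : ℕ => gam H (n : ℤ) ^ 2 := by
    rw [← summable_nat_add_iff 3]
    have hs : Summable fun n : ℕ => C ^ 2 * ((n + 1 : ℕ) : ℝ) ^ (4 * H - 4) :=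
      ((summable_nat_add_iff 1).2 (Real.summable_nat_rpow.2 (by linarith))).mul_left _
    refine hs.of_nonneg_of_le (fun n => sq_nonneg _) (fun n => ?_)
    rw [← sq_abs]
    refine (pow_le_pow_left₀ (abs_nonneg _) (hC n) 2).trans_eq ?_
    rw [mul_pow, ← Real.rpow_mul_natCast (by positivity)]
    congr 2
    push_cast
    ring
  exact Summable.of_nat_of_neg hnat (by simpa only [gam_neg] using hnat)

/-- For `0 < H < 3/4` and all integers `α, β`, the series
`∑_{i ∈ ℤ} |γ(H,i+α) γ(H,i+β)|` converges; in particular `∑_{i ∈ ℤ} γ(H,i)² < ∞` and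
`∑_{i ∈ ℤ} |γ(H,i+α) γ(H,i+β)| ≤ ∑_{i ∈ ℤ} γ(H,i)²`. -/
theorem gamma_products_summable (H : ℝ) (hH1 : 0 < H) (hH2 : H < 3/4) (α β : ℤ) :
    Summable (fun i : ℤ => |gam H (i+α) * gam H (i+β)|) ∧
    Summable (fun i : ℤ => (gam H i)^2) ∧
    ∑' i : ℤ, |gam H (i+α) * gam H (i+β)| ≤ ∑' i : ℤ, (gam H i)^2 := by
  have hs := summable_gam_sq hH2
  have hshift (a : ℤ) : Summable fun i : ℤ => gam H (i + a) ^ 2 :=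
    (Equiv.addRight a).summable_iff.2 hs
  have htsum (a : ℤ) : ∑' i : ℤ, gam H (i + a) ^ 2 = ∑' i : ℤ, gam H i ^ 2 :=
    (Equiv.addRight a).tsum_eq fun i => gam H i ^ 2
  have hle (i : ℤ) : |gam H (i + α) * gam H (i + β)| ≤
      (gam H (i + α) ^ 2 + gam H (i + β) ^ 2) / 2 := by
    rw [abs_mul, ← sq_abs (gam H (i + α)), ← sq_abs (gam H (i + β))]
    linarith [two_mul_le_add_sq |gam H (i + α)| |gam H (i + β)|]
  have hsum := ((hshift α).add (hshift β)).div_const 2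
  have hprod := hsum.of_nonneg_of_le (fun i => abs_nonneg _) hle
  refine ⟨hprod, hs, (hprod.tsum_le_tsum hle hsum).trans_eq ?_⟩
  rw [tsum_div_const, (hshift α).tsum_add (hshift β), htsum, htsum]
  ring
end
end

section
/- Fix h > 0 and let f : (0,1) × (0,∞) → ℝ² be given by f(H, v) = (f₁(H,v), f₂(H,v)) with f₁(H,v) = 2 h^{2H} v (2^{2H} − 1) / ((2H+1)(H+1)) and f₂(H,v) = 2 h^{2H} 2^{2H} v (2^{2H} − 1) / ((2H+1)(H+1)). Then for every H ∈ (0,1) and every a ≠ 0, the determinant of the Jacobian matrix of f at (H, a²) equals − a² h^{4H} 2^{2H+3} (log 2) (2^{2H} − 1)² / ((2H+1)²(H+1)²); in particular this determinant is strictly negative, so the Jacobian matrix f'(H, a²) is invertible. -/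
open MeasureTheory ProbabilityTheory Filter Real Matrix Topology

noncomputable section

variable {Ω : Type*} [MeasurableSpace Ω]

/-- `f₁(H, v) = 2 h^{2H} v (2^{2H} - 1) / ((2H+1)(H+1))`. -/
def fOne (h H v : ℝ) : ℝ := 2 * h^(2*H) * v * ((2:ℝ)^(2*H) - 1) / ((2*H+1)*(H+1))

/-- `f₂(H, v) = 2 h^{2H} 2^{2H} v (2^{2H} - 1) / ((2H+1)(H+1))`. -/
def fTwo (h H v : ℝ) : ℝ :=
  2 * h^(2*H) * (2:ℝ)^(2*H) * v * ((2:ℝ)^(2*H) - 1) / ((2*H+1)*(H+1))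

/-- The Jacobian matrix `f'(H, v)` of `f = (f₁, f₂)`, whose entries are the partial
derivatives of `f₁, f₂` with respect to `H` and `v`. -/
def Jac (h H v : ℝ) : Matrix (Fin 2) (Fin 2) ℝ :=
  !![deriv (fun H' => fOne h H' v) H, deriv (fun v' => fOne h H v') v;
     deriv (fun H' => fTwo h H' v) H, deriv (fun v' => fTwo h H v') v]

theorem fOne_eq_mul (h H v : ℝ) : fOne h H v = fOne h H 1 * v := by
  unfold fOne
  ring

theorem fTwo_eq_mul (h H v : ℝ) : fTwo h H v = (2:ℝ)^(2*H) * fOne h H v := by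
  unfold fTwo fOne
  ring

theorem hasDerivAt_const_rpow_two_mul {c : ℝ} (hc : 0 < c) (H : ℝ) :
    HasDerivAt (fun x : ℝ => c^(2*x)) (2 * Real.log c * c^(2*H)) H := by
  convert ((hasDerivAt_id' H).const_mul 2).const_rpow hc using 1
  ring

theorem differentiableAt_fOne {h H : ℝ} (hh : 0 < h) (hH : 0 < H) (v : ℝ) :
    DifferentiableAt ℝ (fun x => fOne h x v) H := by
  have hp := (hasDerivAt_const_rpow_two_mul hh H).differentiableAt
  have h2 := (hasDerivAt_const_rpow_two_mul two_pos H).differentiableAt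
  unfold fOne
  refine DifferentiableAt.fun_div (by fun_prop) (by fun_prop) ?_
  positivity

/-- Since `f₂ = 2^{2H} f₁` and `f₁` is linear in `v`, only the derivative of `2^{2H}`
survives in the determinant. -/
theorem det_Jac {h H : ℝ} (hh : 0 < h) (hH : 0 < H) (v : ℝ) :
    (Jac h H v).det = -(2 * Real.log 2 * (2:ℝ)^(2*H) * v * fOne h H 1 ^ 2) := by
  have hOne := (differentiableAt_fOne hh hH v).hasDerivAt
  have hTwo : deriv (fun x => fTwo h x v) H = 2 * Real.log 2 * (2:ℝ)^(2*H) * fOne h H v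
      + (2:ℝ)^(2*H) * deriv (fun x => fOne h x v) H := by
    simp only [fTwo_eq_mul]
    exact ((hasDerivAt_const_rpow_two_mul two_pos H).fun_mul hOne).deriv
  have hOne' : deriv (fun w => fOne h H w) v = fOne h H 1 := by
    rw [funext (fOne_eq_mul h H)]
    simp
  have hTwo' : deriv (fun w => fTwo h H w) v = (2:ℝ)^(2*H) * fOne h H 1 := by
    simp only [fTwo_eq_mul]
    rw [deriv_const_mul_field, hOne']
  rw [Jac, Matrix.det_fin_two_of, hTwo, hOne', hTwo', fOne_eq_mul h H v]
  ring

/-- For every `H ∈ (0,1)` and `a ≠ 0`, the determinant of the Jacobian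
of `f = (f₁,f₂)` at `(H, a²)` equals
`- a² h^{4H} 2^{2H+3} (log 2) (2^{2H}-1)² / ((2H+1)²(H+1)²)`; in particular it is
strictly negative, so the Jacobian matrix is invertible. -/
theorem jacobian_det_one_nifBm
    (h : ℝ) (hh : 0 < h) (H : ℝ) (hH : H ∈ Set.Ioo (0:ℝ) 1) (a : ℝ) (ha : a ≠ 0) :
    (Jac h H (a^2)).det
      = -(a^2 * h^(4*H) * (2:ℝ)^(2*H+3) * Real.log 2 * ((2:ℝ)^(2*H) - 1)^2
          / ((2*H+1)^2 * (H+1)^2)) ∧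
    (Jac h H (a^2)).det < 0 ∧ IsUnit (Jac h H (a^2)) := by
  obtain ⟨hH0, -⟩ := hH
  have hlog : 0 < Real.log 2 := Real.log_pos one_lt_two
  have hp : 0 < (2:ℝ)^(2*H) - 1 :=
    sub_pos.2 (Real.one_lt_rpow one_lt_two (by positivity))
  have hneg : (Jac h H (a^2)).det < 0 := by
    rw [det_Jac hh hH0, neg_lt_zero]
    unfold fOne
    positivity
  refine ⟨?_, hneg, (Matrix.isUnit_iff_isUnit_det _).2 hneg.ne.isUnit⟩
  have h4 : h^(4*H) = (h^(2*H))^2 := by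
    rw [← Real.rpow_mul_natCast hh.le]
    congr 1
    push_cast
    ring
  have h8 : (2:ℝ)^(2*H+3) = (2:ℝ)^(2*H) * 8 := by
    rw [Real.rpow_add two_pos]
    norm_num
  rw [det_Jac hh hH0, fOne, h4, h8]
  field_simp
  ring
end
end
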